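/- arXiv:1507.08349 — 2 statements merged into one kernel-verified Lean document; each statement's English description precedes it below -/
import Mathlib

section
/- Let X be a real-valued random variable with a pdf, finite differential entropy h(X), and finite H(⌊X⌋). Suppose a family of quantizers q (parametrized by D > 0), with quantization regions S_i and reconstruction values x̂_i, satisfies the distortion constraint E[|X − q(X)|^r] ≤ D and achieves liminf_{D↓0} { H(q(X)) − R(D) } = (1/r) log( Γ(1+1/r)^r · e / (1 + 1/r) ). Then for every ϑ > 0: lim_{ρ→∞} limsup_{D↓0} ∑_i P(X ∈ S_i) · 1{ | Λ_{i,ρD^{1/r}}^r / D − 2^r(1+r) | ≤ ϑ } = 1, where Λ_{i,ρD^{1/r}} is the Lebesgue measure of { x ∈ S_i : |x − x̂_i| ≤ ρ D^{1/r} }. -/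
open MeasureTheory Filter Set
open scoped ENNReal Topology ProbabilityTheory Pointwise

noncomputable section

/-- `N` is a norm on `ℝ^d`. -/
structure IsNorm {d : ℕ} (N : (Fin d → ℝ) → ℝ) : Prop where
  nonneg : ∀ x, 0 ≤ N x
  eq_zero_iff : ∀ x, N x = 0 ↔ x = 0
  smul : ∀ (c : ℝ) (x : Fin d → ℝ), N (c • x) = |c| * N x
  triangle : ∀ x y, N (x + y) ≤ N x + N y

/-- Lebesgue volume `V_d` of the unit ball of the norm `N`. -/
def unitBallVol {d : ℕ} (N : (Fin d → ℝ) → ℝ) : ℝ :=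
  (volume {x : Fin d → ℝ | N x ≤ 1}).toReal

/-- A (symbol-wise) quantizer: countably many disjoint Borel quantization regions `S i`
covering the space, with reconstruction values `c i`. -/
structure Quantizer (E : Type*) [MeasurableSpace E] where
  S : ℤ → Set E
  c : ℤ → E
  meas : ∀ i, MeasurableSet (S i)
  disj : Pairwise (Function.onFun Disjoint S)
  cover : ⋃ i, S i = Set.univ

/-- Expected `r`-th power distortion `E[‖X - q(X)‖^r]` of a quantizer, for a source with law `μ`
and norm `N`. -/
def Quantizer.distortion {E : Type*} [MeasurableSpace E] [Sub E] (q : Quantizer E)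
    (μ : Measure E) (N : E → ℝ) (r : ℝ) : ℝ≥0∞ :=
  ∑' i, ∫⁻ x in q.S i, ENNReal.ofReal (N (x - q.c i) ^ r) ∂μ

/-- Output entropy `H(q(X)) = -∑ pᵢ log pᵢ` of a quantizer (as an extended nonneg. real). -/
def Quantizer.entropy {E : Type*} [MeasurableSpace E] (q : Quantizer E) (μ : Measure E) : ℝ≥0∞ :=
  ∑' i, ENNReal.ofReal (Real.negMulLog (μ (q.S i)).toReal)

/-- Output entropy `H(q(X)) = -∑ pᵢ log pᵢ` of a quantizer (as a real number). -/
def Quantizer.entropyR {E : Type*} [MeasurableSpace E] (q : Quantizer E) (μ : Measure E) : ℝ :=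
  ∑' i, Real.negMulLog (μ (q.S i)).toReal

open scoped Classical in
/-- Kullback-Leibler divergence between two measures. -/
def klDiv {α : Type*} [MeasurableSpace α] (μ ν : Measure α) : ℝ≥0∞ :=
  if μ ≪ ν ∧ Integrable (fun x => Real.log (μ.rnDeriv ν x).toReal) μ
  then ENNReal.ofReal (∫ x, Real.log (μ.rnDeriv ν x).toReal ∂μ)
  else ⊤

/-- Mutual information of a joint law `π`, i.e. the KL divergence of `π` from the product of
its marginals. -/
def mutualInfo {α β : Type*} [MeasurableSpace α] [MeasurableSpace β]
    (π : Measure (α × β)) : ℝ≥0∞ :=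
  klDiv π ((π.map Prod.fst).prod (π.map Prod.snd))

/-- The rate-distortion function `R(D)`: the infimum of the mutual information `I(X; X̂)` over
all Markov kernels `P_{X̂|X}` with expected `r`-th power distortion at most `D`. -/
def RDfun {E : Type*} [MeasurableSpace E] [Sub E] (μ : Measure E) (N : E → ℝ) (r D : ℝ) :
    ℝ≥0∞ :=
  ⨅ (κ : ProbabilityTheory.Kernel E E) (_ : ProbabilityTheory.IsMarkovKernel κ)
    (_ : ∫⁻ p, ENNReal.ofReal (N (p.1 - p.2) ^ r) ∂(μ.compProd κ) ≤ ENNReal.ofReal D),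
    mutualInfo (μ.compProd κ)

/-- The smallest output entropy `R_{r,d}(D)` of a quantizer with `r`-th power distortion
at most `D`. -/
def RQfun {E : Type*} [MeasurableSpace E] [Sub E] (μ : Measure E) (N : E → ℝ) (r D : ℝ) :
    ℝ≥0∞ :=
  ⨅ (q : Quantizer E) (_ : q.distortion μ N r ≤ ENNReal.ofReal D), q.entropy μ

/-- The asymptotic excess rate `ℛ = liminf_{D ↓ 0} (R_{r,d}(D) - R(D))`. -/
def excessRate {E : Type*} [MeasurableSpace E] [Sub E] (μ : Measure E) (N : E → ℝ) (r : ℝ) :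
    ℝ :=
  Filter.liminf (fun D => (RQfun μ N r D).toReal - (RDfun μ N r D).toReal) (𝓝[>] (0:ℝ))

/-- The upper incomplete Gamma function `Γ(s, a) = ∫_a^∞ ξ^(s-1) e^(-ξ) dξ`. -/
def uGamma (s a : ℝ) : ℝ := ∫ ξ in Set.Ioi a, ξ ^ (s - 1) * Real.exp (-ξ)

/-- The part of the quantization cell `S i` within distance `ε` of the reconstruction point. -/
def Bcell {E : Type*} [MeasurableSpace E] [Sub E] (q : Quantizer E) (N : E → ℝ) (ε : ℝ)
    (i : ℤ) : Set E :=
  {x | x ∈ q.S i ∧ N (x - q.c i) ≤ ε}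

/-- Normalizing constant of the density proportional to `exp (-|z|^r / r)`. -/
def genGaussConst (r : ℝ) : ℝ := 2 * r ^ (1 / r) * Real.Gamma (1 + 1 / r)

/-- The density maximizing differential entropy among densities with unit `r`-th moment. -/
def genGauss (r z : ℝ) : ℝ := Real.exp (-(|z| ^ r / r)) / genGaussConst r

lemma genGaussConst_pos {r : ℝ} (hr : 0 < r) : 0 < genGaussConst r := by
  have := Real.Gamma_pos_of_pos (show 0 < 1 + 1 / r by positivity)
  unfold genGaussConst; positivity

lemma genGauss_pos {r : ℝ} (hr : 0 < r) (z : ℝ) : 0 < genGauss r z :=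
  div_pos (Real.exp_pos _) (genGaussConst_pos hr)

lemma measurable_genGauss (r : ℝ) : Measurable (genGauss r) := by
  unfold genGauss; fun_prop

lemma log_genGauss {r : ℝ} (hr : 0 < r) (z : ℝ) :
    Real.log (genGauss r z) = -(|z| ^ r / r) - Real.log (genGaussConst r) := by
  rw [genGauss, Real.log_div (Real.exp_pos _).ne' (genGaussConst_pos hr).ne', Real.log_exp]

lemma integral_abs_rpow_mul_genGauss {r q : ℝ} (hr : 0 < r) (hq : -1 < q) :
    ∫ z, |z| ^ q * genGauss r z
      = 2 * ((1 / r) ^ (-(q + 1) / r) * (1 / r) * Real.Gamma ((q + 1) / r))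
          / genGaussConst r := by
  have h := integral_comp_abs (f := fun z : ℝ => z ^ q * Real.exp (-(1 / r) * z ^ r))
  rw [integral_rpow_mul_exp_neg_mul_rpow hr hq (by positivity)] at h
  rw [← h, ← integral_div]
  congr 1; ext z
  rw [genGauss]
  have : -(|z| ^ r / r) = -(1 / r) * |z| ^ r := by ring
  rw [this]; ring

lemma integrable_abs_rpow_mul_genGauss {r q : ℝ} (hr : 0 < r) (hq : -1 < q) :
    Integrable fun z => |z| ^ q * genGauss r z := by
  by_contra h
  have h0 := integral_undef h
  rw [integral_abs_rpow_mul_genGauss hr hq] at h0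
  have := Real.Gamma_pos_of_pos (show 0 < (q + 1) / r from div_pos (by linarith) hr)
  have := genGaussConst_pos hr
  have : 0 < 2 * ((1 / r) ^ (-(q + 1) / r) * (1 / r) * Real.Gamma ((q + 1) / r))
          / genGaussConst r := by positivity
  linarith

lemma integral_genGauss {r : ℝ} (hr : 0 < r) : ∫ z, genGauss r z = 1 := by
  have h := integral_abs_rpow_mul_genGauss (q := 0) hr (by norm_num)
  simp only [Real.rpow_zero, one_mul, zero_add] at h
  rw [h, div_eq_one_iff_eq (genGaussConst_pos hr).ne', genGaussConst, add_comm 1 (1 / r),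
    Real.Gamma_add_one (by positivity), neg_div, Real.rpow_neg (by positivity),
    ← Real.inv_rpow (by positivity), one_div, inv_inv]
  ring

lemma integrable_genGauss {r : ℝ} (hr : 0 < r) : Integrable (genGauss r) := by
  simpa using integrable_abs_rpow_mul_genGauss (q := 0) hr (by norm_num)

lemma integral_abs_rpow_self_mul_genGauss {r : ℝ} (hr : 0 < r) :
    ∫ z, |z| ^ r * genGauss r z = 1 := by
  rw [integral_abs_rpow_mul_genGauss hr (by linarith),
    div_eq_one_iff_eq (genGaussConst_pos hr).ne', genGaussConst]
  have h1 : (r + 1) / r = 1 + 1 / r := by field_simp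
  have h2 : -(r + 1) / r = -(1 + 1 / r) := by field_simp
  rw [h1, h2, Real.rpow_neg (by positivity), ← Real.inv_rpow (by positivity), one_div, inv_inv,
    Real.rpow_add hr, Real.rpow_one]
  field_simp

/-- The length of the optimal quantization cell at unit distortion. -/
def cellLength (r : ℝ) : ℝ := 2 * (1 + r) ^ (1 / r)

lemma cellLength_pos {r : ℝ} (hr : 0 < r) : 0 < cellLength r := by
  unfold cellLength; positivity

lemma cellLength_rpow {r : ℝ} (hr : 0 < r) : cellLength r ^ r = 2 ^ r * (1 + r) := by
  rw [cellLength, Real.mul_rpow (by norm_num) (by positivity), ← Real.rpow_mul (by positivity),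
    one_div_mul_cancel hr.ne', Real.rpow_one]

lemma excess_eq {r : ℝ} (hr : 0 < r) :
    (1 / r) * Real.log (Real.Gamma (1 + 1 / r) ^ r * Real.exp 1 / (1 + 1 / r))
      = Real.log (genGaussConst r) + 1 / r - Real.log (cellLength r) := by
  have hG := Real.Gamma_pos_of_pos (show 0 < 1 + 1 / r by positivity)
  have h1 : 1 + 1 / r = (1 + r) / r := by field_simp; ring
  rw [genGaussConst, cellLength, Real.log_div (by positivity) (by positivity),
    Real.log_mul (by positivity) (by positivity), Real.log_rpow hG, Real.log_exp,
    Real.log_mul (by positivity) (by positivity), Real.log_mul (by positivity) (by positivity),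
    Real.log_mul (by positivity) (by positivity), Real.log_rpow hr,
    Real.log_rpow (by positivity)]
  nth_rewrite 2 [h1]
  rw [Real.log_div (by positivity) hr.ne']
  field_simp
  ring

lemma excess_pos {r : ℝ} (hr : 0 < r) :
    0 < (1 / r) * Real.log (Real.Gamma (1 + 1 / r) ^ r * Real.exp 1 / (1 + 1 / r)) := by
  have hG := Real.Gamma_pos_of_pos (show 0 < 1 + 1 / r by positivity)
  refine mul_pos (by positivity) (Real.log_pos ?_)
  rw [one_lt_div (by positivity)]
  set a : ℝ := (1 + 1 / r) ^ (1 / r) with ha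
  have ha0 : 0 < a := by positivity
  have har : a ^ r = 1 + 1 / r := by
    rw [ha, ← Real.rpow_mul (by positivity), one_div_mul_cancel hr.ne', Real.rpow_one]
  have hI : ∫ x in Ioi (0:ℝ), Real.exp (-x ^ r) = Real.Gamma (1 / r + 1) :=
    integral_exp_neg_rpow hr
  have hexp : IntegrableOn (fun x : ℝ => Real.exp (-x ^ r)) (Ioi 0) := by
    by_contra h
    have h0 := integral_undef h
    rw [hI, add_comm] at h0
    linarith
  have hsplit : Ioi (0:ℝ) = Ioc 0 a ∪ Ioi a := (Ioc_union_Ioi_eq_Ioi ha0.le).symm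
  have hi1 : IntegrableOn (fun x : ℝ => Real.exp (-x ^ r)) (Ioc 0 a) :=
    hexp.mono_set (by rw [hsplit]; exact subset_union_left)
  have hi2 : IntegrableOn (fun x : ℝ => Real.exp (-x ^ r)) (Ioi a) :=
    hexp.mono_set (by rw [hsplit]; exact subset_union_right)
  have hpos : 0 < ∫ x in Ioi a, Real.exp (-x ^ r) := by
    rw [setIntegral_pos_iff_support_of_nonneg_ae (Eventually.of_forall fun x => (Real.exp_pos _).le)
      hi2]
    have : (Function.support fun x : ℝ => Real.exp (-x ^ r)) = univ := by
      ext x; simp [Real.exp_ne_zero]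
    simp [this]
  have hcont : ContinuousOn (fun x : ℝ => x ^ r) (uIcc 0 a) :=
    fun x _ => (Real.continuousAt_rpow_const x r (Or.inr hr.le)).continuousWithinAt
  have hlow : a * Real.exp (-(1 / r)) ≤ ∫ x in Ioc 0 a, Real.exp (-x ^ r) := by
    rw [← intervalIntegral.integral_of_le ha0.le]
    have e1 : ∫ x in (0:ℝ)..a, Real.exp (-(1 / r)) * ((1 + 1 / r) - x ^ r)
        = a * Real.exp (-(1 / r)) := by
      rw [intervalIntegral.integral_const_mul, intervalIntegral.integral_sub (by simp)
        hcont.intervalIntegrable, integral_rpow (Or.inl (by linarith)),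
        intervalIntegral.integral_const, Real.zero_rpow (by linarith), Real.rpow_add_one ha0.ne',
        har, smul_eq_mul]
      field_simp
      ring
    rw [← e1]
    refine intervalIntegral.integral_mono_on ha0.le
      (((continuousOn_const.sub hcont).const_mul _).intervalIntegrable)
      ((hcont.neg.rexp).intervalIntegrable) fun x _ => ?_
    have : Real.exp (-x ^ r) = Real.exp (-(1 / r)) * Real.exp (1 / r - x ^ r) := by
      rw [← Real.exp_add]; congr 1; ring
    rw [this]
    refine mul_le_mul_of_nonneg_left ?_ (Real.exp_pos _).le
    have := Real.add_one_le_exp (1 / r - x ^ r)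
    linarith
  have hlt : a * Real.exp (-(1 / r)) < Real.Gamma (1 + 1 / r) := by
    have hdisj : Disjoint (Ioc 0 a) (Ioi a) :=
      Set.disjoint_left.2 fun x hx hx' => not_lt.2 hx.2 hx'
    rw [add_comm 1 (1 / r), ← hI, hsplit, setIntegral_union hdisj measurableSet_Ioi hi1 hi2]
    linarith
  have h2 := Real.rpow_lt_rpow (by positivity) hlt hr
  rw [Real.mul_rpow ha0.le (Real.exp_pos _).le, har, ← Real.exp_mul, neg_mul,
    one_div_mul_cancel hr.ne'] at h2
  calc 1 + 1 / r = (1 + 1 / r) * Real.exp (-1) * Real.exp 1 := by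
        rw [mul_assoc, ← Real.exp_add]; simp
    _ < _ := by gcongr

lemma HasCompactSupport.tendsto_integral_abs_translate_sub {g : ℝ → ℝ} (hc : HasCompactSupport g)
    (hg : Continuous g) : Tendsto (fun a => ∫ x, |g (x + a) - g x|) (𝓝 0) (𝓝 0) := by
  obtain ⟨R, hR⟩ := hc.isCompact.isBounded.subset_closedBall 0
  have hzero : ∀ x, R < |x| → g x = 0 := fun x hx => by
    by_contra h
    have := hR (subset_tsupport g h)
    rw [mem_closedBall_zero_iff, Real.norm_eq_abs] at this
    linarith
  have hco : ContinuousOn (fun a => ∫ x, |g (x + a) - g x|) (Icc (-1) 1) := by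
    refine continuousOn_integral_of_compact_support
      (f := fun a x : ℝ => |g (x + a) - g x|) (isCompact_closedBall (0:ℝ) (R + 1)) ?_ ?_
    · apply Continuous.continuousOn
      simp only [Function.uncurry_def]
      fun_prop
    · intro a x ha hx
      rw [mem_closedBall_zero_iff, Real.norm_eq_abs, not_le] at hx
      have h1 : |a| ≤ 1 := abs_le.2 ha
      have h2 : |x| ≤ |x + a| + |a| := by
        have := abs_sub (x + a) a
        simpa using this
      rw [hzero x (by linarith), hzero (x + a) (by linarith)]
      simp
  have := (hco 0 (by simp)).continuousAt (Icc_mem_nhds (by norm_num) (by norm_num))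
  simpa [ContinuousAt] using this

lemma MeasureTheory.Integrable.tendsto_integral_abs_translate_sub {f : ℝ → ℝ} (hf : Integrable f) :
    Tendsto (fun a => ∫ x, |f (x + a) - f x|) (𝓝 0) (𝓝 0) := by
  rw [Metric.tendsto_nhds]
  intro η hη
  obtain ⟨g, hgc, hfg, hg, hgi⟩ := hf.exists_hasCompactSupport_integral_sub_le
    (show 0 < η / 4 by positivity)
  have h1 := (hgc.tendsto_integral_abs_translate_sub hg).eventually_lt_const
    (show 0 < η / 4 by positivity)
  filter_upwards [h1] with a ha
  have hfa : Integrable fun x => f (x + a) := hf.comp_add_right a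
  have hga : Integrable fun x => g (x + a) := hgi.comp_add_right a
  have h2 : ∫ x, |f (x + a) - f x| ≤
      ∫ x, (|f (x + a) - g (x + a)| + |g (x + a) - g x| + |f x - g x|) := by
    refine integral_mono (hfa.sub hf).abs (((hfa.sub hga).abs.add (hga.sub hgi).abs).add
      (hf.sub hgi).abs) fun x => ?_
    have e : f (x + a) - f x = (f (x + a) - g (x + a)) + (g (x + a) - g x) - (f x - g x) := by ring
    dsimp only
    rw [e]
    exact (abs_sub _ _).trans (by gcongr; exact abs_add_le _ _)
  have h3 : ∫ x, |f (x + a) - g (x + a)| = ∫ x, |f x - g x| :=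
    integral_add_right_eq_self (fun x => |f x - g x|) a
  have e1 : Integrable fun x => |f (x + a) - g (x + a)| := (hfa.sub hga).abs
  have e2 : Integrable fun x => |g (x + a) - g x| := (hga.sub hgi).abs
  have e3 : Integrable fun x => |f x - g x| := (hf.sub hgi).abs
  have e12 : Integrable fun x => |f (x + a) - g (x + a)| + |g (x + a) - g x| := e1.add e2
  rw [integral_add e12 e3, integral_add e1 e2, h3] at h2
  simp only [Real.norm_eq_abs] at hfg
  rw [Real.dist_0_eq_abs, abs_of_nonneg (integral_nonneg fun x => abs_nonneg _)]
  linarith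

section density
variable {μ : Measure ℝ} {f : ℝ → ℝ}

lemma integral_eq_of_density (hfm : Measurable f) (hf0 : ∀ x, 0 ≤ f x)
    (hμf : μ = volume.withDensity fun x => ENNReal.ofReal (f x)) (T : ℝ → ℝ) :
    ∫ x, T x ∂μ = ∫ x, f x * T x := by
  rw [hμf, integral_withDensity_eq_integral_toReal_smul hfm.ennreal_ofReal
    (Eventually.of_forall fun x => ENNReal.ofReal_lt_top)]
  simp [ENNReal.toReal_ofReal (hf0 _)]

lemma integrable_iff_of_density (hfm : Measurable f) (hf0 : ∀ x, 0 ≤ f x)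
    (hμf : μ = volume.withDensity fun x => ENNReal.ofReal (f x)) (T : ℝ → ℝ) :
    Integrable T μ ↔ Integrable fun x => f x * T x := by
  rw [hμf, integrable_withDensity_iff_integrable_smul' hfm.ennreal_ofReal
    (Eventually.of_forall fun x => ENNReal.ofReal_lt_top)]
  simp [ENNReal.toReal_ofReal (hf0 _)]

lemma ae_pos_of_density (hfm : Measurable f)
    (hμf : μ = volume.withDensity fun x => ENNReal.ofReal (f x)) : ∀ᵐ x ∂μ, 0 < f x := by
  rw [hμf, ae_withDensity_iff hfm.ennreal_ofReal]
  refine Eventually.of_forall fun x hx => ?_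
  simpa using hx

variable [IsProbabilityMeasure μ]

lemma integrable_of_density (hfm : Measurable f) (hf0 : ∀ x, 0 ≤ f x)
    (hμf : μ = volume.withDensity fun x => ENNReal.ofReal (f x)) : Integrable f := by
  simpa using (integrable_iff_of_density hfm hf0 hμf (fun _ => 1)).1 (integrable_const _)

lemma integral_density (hfm : Measurable f) (hf0 : ∀ x, 0 ≤ f x)
    (hμf : μ = volume.withDensity fun x => ENNReal.ofReal (f x)) : ∫ x, f x = 1 := by
  simpa using (integral_eq_of_density hfm hf0 hμf (fun _ => 1)).symm

lemma tendsto_integral_translate (hfm : Measurable f) (hf0 : ∀ x, 0 ≤ f x)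
    (hμf : μ = volume.withDensity fun x => ENNReal.ofReal (f x)) {T : ℝ → ℝ} (hT : Measurable T)
    {K : ℝ} (hK : ∀ x, |T x| ≤ K) :
    Tendsto (fun a => ∫ x, T (x + a) ∂μ) (𝓝 0) (𝓝 (∫ x, T x ∂μ)) := by
  have hf := integrable_of_density hfm hf0 hμf
  have key : ∀ a, |(∫ x, T (x + a) ∂μ) - ∫ x, T x ∂μ| ≤ K * ∫ x, |f (x + -a) - f x| := by
    intro a
    rw [integral_eq_of_density hfm hf0 hμf, integral_eq_of_density hfm hf0 hμf]
    have e : ∫ x, f x * T (x + a) = ∫ x, f (x + -a) * T x := by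
      rw [← integral_add_right_eq_self (fun x => f (x + -a) * T x) a]
      simp
    have b : ∀ {u : ℝ → ℝ}, Integrable u → Integrable fun x => u x * T x := fun hu =>
      hu.mul_bdd (c := K) hT.aestronglyMeasurable (Eventually.of_forall hK)
    have hfa : Integrable fun x => f (x + -a) := hf.comp_add_right (-a)
    rw [e, ← integral_sub (b hfa) (b hf), ← integral_const_mul]
    refine (abs_integral_le_integral_abs).trans (integral_mono_of_nonneg
      (Eventually.of_forall fun x => abs_nonneg _) ((hfa.sub hf).abs.const_mul K)
      (Eventually.of_forall fun x => ?_))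
    simp only
    rw [← sub_mul, abs_mul, mul_comm]
    exact mul_le_mul_of_nonneg_right (hK x) (abs_nonneg _)
  have h0 : Tendsto (fun a => K * ∫ x, |f (x + -a) - f x|) (𝓝 0) (𝓝 0) := by
    have := (hf.tendsto_integral_abs_translate_sub.comp
      (by simpa using (continuous_neg (G := ℝ)).tendsto 0)).const_mul K
    simpa using this
  rw [tendsto_iff_dist_tendsto_zero]
  exact squeeze_zero (fun _ => dist_nonneg) key h0

lemma tendsto_integral_prod_add_mul (hfm : Measurable f) (hf0 : ∀ x, 0 ≤ f x)
    (hμf : μ = volume.withDensity fun x => ENNReal.ofReal (f x)) (γ : Measure ℝ)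
    [IsProbabilityMeasure γ] {T : ℝ → ℝ} (hT : Measurable T) {K : ℝ} (hK : ∀ x, |T x| ≤ K) :
    Tendsto (fun ε : ℝ => ∫ p, T (p.1 + ε * p.2) ∂(μ.prod γ)) (𝓝[>] 0) (𝓝 (∫ x, T x ∂μ)) := by
  have e : ∀ ε : ℝ, ∫ p, T (p.1 + ε * p.2) ∂(μ.prod γ) = ∫ z, ∫ x, T (x + ε * z) ∂μ ∂γ :=
    fun ε => integral_prod_symm _ (Integrable.of_bound (C := K)
      (by apply Measurable.aestronglyMeasurable; fun_prop) (Eventually.of_forall fun p => hK _))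
  simp_rw [e]
  have h1 : ∫ x, T x ∂μ = ∫ _z, ∫ x, T x ∂μ ∂γ := by simp
  rw [h1]
  refine tendsto_integral_filter_of_dominated_convergence (fun _ => K)
    (Eventually.of_forall fun ε => ?_) (Eventually.of_forall fun ε => Eventually.of_forall
      fun z => ?_) (integrable_const _) (Eventually.of_forall fun z => ?_)
  · have : StronglyMeasurable fun p : ℝ × ℝ => T (p.2 + ε * p.1) := by
      apply Measurable.stronglyMeasurable; fun_prop
    exact this.integral_prod_right.aestronglyMeasurable
  · simpa using norm_integral_le_of_norm_le_const (μ := μ) (f := fun x => T (x + ε * z)) (C := K)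
      (Eventually.of_forall fun x => hK _)
  · refine (tendsto_integral_translate hfm hf0 hμf hT hK).comp ?_
    have : Tendsto (fun ε : ℝ => ε * z) (𝓝 0) (𝓝 0) := by
      simpa using (continuous_mul_const z).tendsto 0
    exact this.mono_left nhdsWithin_le_nhds

end density

section index
variable {α : Type*} [MeasurableSpace α] {μ : Measure α} {I : α → ℤ}

lemma integral_comp_index (hI : Measurable I) {a : ℤ → ℝ}
    (ha : Integrable (fun x => a (I x)) μ) :
    ∫ x, a (I x) ∂μ = ∑' i, (μ (I ⁻¹' {i})).toReal * a i := by
  have ha' : Integrable a (μ.map I) := by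
    rw [integrable_map_measure (measurable_of_countable a).aestronglyMeasurable hI.aemeasurable]
    exact ha
  have := integral_map (μ := μ) hI.aemeasurable (f := a)
    (measurable_of_countable a).aestronglyMeasurable
  rw [← this, integral_countable ha']
  simp [Measure.real, Measure.map_apply hI (measurableSet_singleton _)]

variable [IsProbabilityMeasure μ]

lemma integrable_comp_index (hI : Measurable I) {a : ℤ → ℝ}
    (ha : Summable fun i => (μ (I ⁻¹' {i})).toReal * |a i|) :
    Integrable (fun x => a (I x)) μ := by
  have hcell : ∀ i, MeasurableSet (I ⁻¹' {i}) := fun i => hI (measurableSet_singleton i)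
  have hU : ⋃ i, I ⁻¹' {i} = univ := by ext x; simp
  rw [← integrableOn_univ, ← hU]
  refine integrableOn_iUnion_of_summable_integral_norm (fun i => ?_) (ha.congr fun i => ?_)
  · exact (integrableOn_const (measure_ne_top _ _) (C := a i)).congr_fun
      (fun x hx => by rw [show I x = i from hx]) (hcell i)
  · rw [setIntegral_congr_fun (g := fun _ => |a i|) (hcell i)
      (fun x hx => by rw [show I x = i from hx, Real.norm_eq_abs])]
    simp [Measure.real]

lemma integrable_log_index (hI : Measurable I)
    (hs : Summable fun i => Real.negMulLog (μ (I ⁻¹' {i})).toReal) :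
    Integrable (fun x => Real.log (μ (I ⁻¹' {I x})).toReal) μ := by
  refine integrable_comp_index hI (a := fun i => Real.log (μ (I ⁻¹' {i})).toReal)
    (hs.congr fun i => ?_)
  have h1 : (μ (I ⁻¹' {i})).toReal ≤ 1 := ENNReal.toReal_le_of_le_ofReal zero_le_one
    (by simpa using prob_le_one)
  rw [abs_of_nonpos (Real.log_nonpos ENNReal.toReal_nonneg h1), Real.negMulLog]
  ring

lemma integral_neg_log_index (hI : Measurable I)
    (hs : Summable fun i => Real.negMulLog (μ (I ⁻¹' {i})).toReal) :
    ∫ x, -Real.log (μ (I ⁻¹' {I x})).toReal ∂μ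
      = ∑' i, Real.negMulLog (μ (I ⁻¹' {i})).toReal := by
  rw [integral_comp_index hI (a := fun i => -Real.log (μ (I ⁻¹' {i})).toReal)
    (integrable_log_index hI hs).neg]
  congr 1; ext i
  rw [Real.negMulLog]; ring

lemma ae_index_pos (I : α → ℤ) : ∀ᵐ x ∂μ, 0 < (μ (I ⁻¹' {I x})).toReal := by
  have h : μ (⋃ i ∈ {i | μ (I ⁻¹' {i}) = 0}, I ⁻¹' {i}) = 0 :=
    (measure_biUnion_null_iff (to_countable _)).2 fun i hi => hi
  filter_upwards [measure_eq_zero_iff_ae_notMem.1 h] with x hx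
  refine ENNReal.toReal_pos (fun h0 => hx ?_) (measure_ne_top _ _)
  exact mem_biUnion (x := I x) h0 rfl

end index

section laplace
variable (μ : Measure ℝ)

/-- Convolution of a measure with the unnormalized Laplace density. -/
def laplaceSmooth (x : ℝ) : ℝ := ∫ y, Real.exp (-|x - y|) ∂μ

variable [IsProbabilityMeasure μ]

lemma integrable_exp_neg_abs_sub (x : ℝ) : Integrable (fun y => Real.exp (-|x - y|)) μ :=
  Integrable.of_bound (C := 1) (by fun_prop) (Eventually.of_forall fun y => by
    rw [Real.norm_eq_abs, Real.abs_exp]; exact Real.exp_le_one_iff.2 (by simp))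

lemma measurable_laplaceSmooth : Measurable (laplaceSmooth μ) := by
  have : StronglyMeasurable fun p : ℝ × ℝ => Real.exp (-|p.1 - p.2|) := by
    apply Continuous.stronglyMeasurable; fun_prop
  exact (this.integral_prod_right (ν := μ)).measurable

lemma laplaceSmooth_pos (x : ℝ) : 0 < laplaceSmooth μ x := by
  rw [laplaceSmooth, integral_pos_iff_support_of_nonneg (fun y => (Real.exp_pos _).le)
    (integrable_exp_neg_abs_sub μ x)]
  have : (Function.support fun y : ℝ => Real.exp (-|x - y|)) = univ := by
    ext y; simp [Real.exp_ne_zero]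
  simp [this]

lemma laplaceSmooth_le_one (x : ℝ) : laplaceSmooth μ x ≤ 1 := by
  have := integral_mono (integrable_exp_neg_abs_sub μ x) (integrable_const 1)
    fun y => Real.exp_le_one_iff.2 (by simp)
  simpa [laplaceSmooth] using this

lemma laplaceSmooth_mul_exp_le (x y : ℝ) :
    laplaceSmooth μ x * Real.exp (-|y - x|) ≤ laplaceSmooth μ y := by
  rw [laplaceSmooth, laplaceSmooth, ← integral_mul_const]
  refine integral_mono ((integrable_exp_neg_abs_sub μ x).mul_const _)
    (integrable_exp_neg_abs_sub μ y) fun z => ?_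
  dsimp only
  rw [← Real.exp_add, Real.exp_le_exp]
  have := abs_sub_le y x z
  linarith

lemma log_laplaceSmooth_sub_le (x y : ℝ) :
    Real.log (laplaceSmooth μ x) - |y - x| ≤ Real.log (laplaceSmooth μ y) := by
  have := Real.log_le_log (mul_pos (laplaceSmooth_pos μ x) (Real.exp_pos _))
    (laplaceSmooth_mul_exp_le μ x y)
  rwa [Real.log_mul (laplaceSmooth_pos μ x).ne' (Real.exp_pos _).ne', Real.log_exp] at this

lemma exp_neg_mul_floor_le_laplaceSmooth (x : ℝ) :
    Real.exp (-1) * (μ (Int.floor ⁻¹' {⌊x⌋})).toReal ≤ laplaceSmooth μ x := by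
  set s : Set ℝ := Int.floor ⁻¹' {⌊x⌋}
  have hs : MeasurableSet s := Int.measurable_floor (measurableSet_singleton _)
  have h : ∫ y, s.indicator (fun _ => Real.exp (-1)) y ∂μ ≤ laplaceSmooth μ x := by
    refine integral_mono ((integrable_const _).indicator hs) (integrable_exp_neg_abs_sub μ x)
      fun y => ?_
    by_cases hy : y ∉ s
    · rw [indicator_of_notMem hy]; exact (Real.exp_pos _).le
    rw [not_not] at hy
    rw [indicator_of_mem hy]
    have hy' : ⌊y⌋ = ⌊x⌋ := hy
    have := Int.abs_sub_lt_one_of_floor_eq_floor hy'.symm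
    exact Real.exp_le_exp.2 (by linarith)
  rw [integral_indicator_const _ hs, smul_eq_mul, Measure.real] at h
  linarith

lemma integrable_log_laplaceSmooth
    (hfloor : Summable fun k : ℤ => Real.negMulLog (μ {x | ⌊x⌋ = k}).toReal) :
    Integrable (fun x => Real.log (laplaceSmooth μ x)) μ := by
  have hI := integrable_log_index (μ := μ) (I := Int.floor) Int.measurable_floor hfloor
  refine Integrable.mono' (g := fun x => 1 + |Real.log (μ (Int.floor ⁻¹' {⌊x⌋})).toReal|)
    ((integrable_const 1).add hI.abs)
    (measurable_laplaceSmooth μ).log.aestronglyMeasurable ?_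
  filter_upwards [ae_index_pos (μ := μ) Int.floor] with x hx
  have h1 := Real.log_nonpos (laplaceSmooth_pos μ x).le (laplaceSmooth_le_one μ x)
  have h2 := Real.log_le_log (mul_pos (Real.exp_pos _) hx) (exp_neg_mul_floor_le_laplaceSmooth μ x)
  rw [Real.log_mul (Real.exp_pos _).ne' hx.ne', Real.log_exp] at h2
  rw [Real.norm_eq_abs, abs_of_nonpos h1]
  have := neg_le_abs (Real.log (μ (Int.floor ⁻¹' {⌊x⌋})).toReal)
  linarith

lemma integrable_laplaceSmooth : Integrable (laplaceSmooth μ) := by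
  have hexp : Integrable fun u : ℝ => Real.exp (-|u|) := by
    by_contra h
    have h0 := integral_undef h
    have := integral_comp_abs (f := fun x : ℝ => Real.exp (-x))
    rw [h0, integral_exp_neg_Ioi_zero] at this
    norm_num at this
  have : Integrable (fun p : ℝ × ℝ => Real.exp (-|p.1 - p.2|)) (volume.prod μ) := by
    rw [integrable_prod_iff' (by apply Continuous.aestronglyMeasurable; fun_prop)]
    refine ⟨Eventually.of_forall fun y => hexp.comp_sub_right y, ?_⟩
    have : ∀ y : ℝ, ∫ x : ℝ, ‖Real.exp (-|x - y|)‖ = ∫ x : ℝ, Real.exp (-|x|) := fun y => by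
      simp_rw [Real.norm_eq_abs, Real.abs_exp]
      exact integral_sub_right_eq_self (fun x : ℝ => Real.exp (-|x|)) y
    simp_rw [this]
    exact integrable_const _
  exact this.integral_prod_left

end laplace

/-- `f` clamped between multiples of `w`. -/
def clampDensity (f w : ℝ → ℝ) (M x : ℝ) : ℝ :=
  max (min (f x) (Real.exp M * w x)) (Real.exp (-M) * w x)

section clamp
variable {f w : ℝ → ℝ} {M : ℝ}

lemma measurable_clampDensity (hf : Measurable f) (hw : Measurable w) :
    Measurable (clampDensity f w M) := by
  unfold clampDensity; fun_prop

lemma clampDensity_pos (hw : ∀ x, 0 < w x) (x : ℝ) : 0 < clampDensity f w M x :=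
  lt_max_of_lt_right (mul_pos (Real.exp_pos _) (hw x))

lemma clampDensity_le (hf : ∀ x, 0 ≤ f x) (hw : ∀ x, 0 < w x) (x : ℝ) :
    clampDensity f w M x ≤ f x + Real.exp (-M) * w x := by
  have := mul_pos (Real.exp_pos (-M)) (hw x)
  exact max_le ((min_le_left _ _).trans (by linarith)) (by linarith [hf x])

lemma abs_log_clampDensity_sub_le (hw : ∀ x, 0 < w x) (hM : 0 ≤ M) (x : ℝ) :
    |Real.log (clampDensity f w M x) - Real.log (w x)| ≤ M := by
  have h1 : Real.exp (-M) * w x ≤ clampDensity f w M x := le_max_right _ _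
  have h2 : clampDensity f w M x ≤ Real.exp M * w x := max_le (min_le_right _ _)
    (mul_le_mul_of_nonneg_right (Real.exp_le_exp.2 (by linarith)) (hw x).le)
  have h3 := Real.log_le_log (mul_pos (Real.exp_pos _) (hw x)) h1
  have h4 := Real.log_le_log (clampDensity_pos hw x) h2
  rw [Real.log_mul (Real.exp_pos _).ne' (hw x).ne', Real.log_exp] at h3 h4
  rw [abs_le]; constructor <;> linarith

lemma abs_log_clampDensity_le (hw : ∀ x, 0 < w x) (hM : 0 ≤ M) {x : ℝ} (hf : 0 < f x) :
    |Real.log (clampDensity f w M x)| ≤ |Real.log (f x)| + |Real.log (w x)| := by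
  have hm := clampDensity_pos (f := f) (M := M) hw x
  have e1 : Real.exp (-M) * w x ≤ w x :=
    mul_le_of_le_one_left (hw x).le (Real.exp_le_one_iff.2 (by linarith))
  have e2 : w x ≤ Real.exp M * w x :=
    le_mul_of_one_le_left (hw x).le (Real.one_le_exp hM)
  have h1 : clampDensity f w M x ≤ max (f x) (w x) :=
    max_le ((min_le_left _ _).trans (le_max_left _ _)) (e1.trans (le_max_right _ _))
  have h2 : min (f x) (w x) ≤ clampDensity f w M x :=
    (min_le_min le_rfl e2).trans (le_max_left _ _)
  have h3 := Real.log_le_log hm h1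
  have h4 := Real.log_le_log (lt_min hf (hw x)) h2
  have a1 := le_abs_self (Real.log (f x)); have a2 := neg_le_abs (Real.log (f x))
  have b1 := le_abs_self (Real.log (w x)); have b2 := neg_le_abs (Real.log (w x))
  have a3 := abs_nonneg (Real.log (f x)); have b3 := abs_nonneg (Real.log (w x))
  rw [abs_le]
  rcases le_total (f x) (w x) with h | h
  · rw [max_eq_right h] at h3; rw [min_eq_left h] at h4
    constructor <;> linarith
  · rw [max_eq_left h] at h3; rw [min_eq_right h] at h4
    constructor <;> linarith

lemma tendsto_clampDensity (hw : ∀ x, 0 < w x) {x : ℝ} (hf : 0 < f x) :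
    ∀ᶠ M in atTop, clampDensity f w M x = f x := by
  have h1 : Tendsto (fun M => Real.exp M * w x) atTop atTop :=
    Real.tendsto_exp_atTop.atTop_mul_const (hw x)
  have h2 : Tendsto (fun M => Real.exp (-M) * w x) atTop (𝓝 0) := by
    simpa using (Real.tendsto_exp_neg_atTop_nhds_zero).mul_const (w x)
  filter_upwards [h1.eventually_ge_atTop (f x), h2.eventually_le_const hf] with M h1 h2
  rw [clampDensity, min_eq_left h1, max_eq_left h2]

end clamp

/-- A log-Lipschitz reference density, up to a bounded factor, that is nearly optimal for `f` in
the Gibbs inequality. -/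
lemma exists_near_density {μ : Measure ℝ} {f : ℝ → ℝ} [IsProbabilityMeasure μ]
    (hfm : Measurable f) (hf0 : ∀ x, 0 ≤ f x)
    (hμf : μ = volume.withDensity fun x => ENNReal.ofReal (f x))
    (hlogf : Integrable (fun x => Real.log (f x)) μ)
    (hfloor : Summable fun k : ℤ => Real.negMulLog (μ {x | ⌊x⌋ = k}).toReal)
    {η : ℝ} (hη : 0 < η) :
    ∃ (g w : ℝ → ℝ) (K : ℝ), Measurable g ∧ (∀ x, 0 < g x) ∧ Integrable g ∧ ∫ x, g x ≤ 1 + η ∧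
      Measurable w ∧ (∀ x, |Real.log (g x) - w x| ≤ K) ∧ (∀ x y, w x - |y - x| ≤ w y) ∧
      Integrable w μ ∧ ∫ x, Real.log (f x) ∂μ - η ≤ ∫ x, Real.log (g x) ∂μ := by
  have hw := laplaceSmooth_pos μ
  have hwm := measurable_laplaceSmooth μ
  have hwi := integrable_laplaceSmooth μ
  have hlogw := integrable_log_laplaceSmooth μ hfloor
  have hfpos := ae_pos_of_density hfm hμf
  have hf := integrable_of_density hfm hf0 hμf
  have hlim : Tendsto (fun M => ∫ x, Real.log (clampDensity f (laplaceSmooth μ) M x) ∂μ) atTop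
      (𝓝 (∫ x, Real.log (f x) ∂μ)) := by
    refine tendsto_integral_filter_of_dominated_convergence
      (fun x => |Real.log (f x)| + |Real.log (laplaceSmooth μ x)|)
      (Eventually.of_forall fun M => (measurable_clampDensity hfm hwm).log.aestronglyMeasurable)
      ?_ (hlogf.abs.add hlogw.abs) ?_
    · filter_upwards [eventually_ge_atTop 0] with M hM
      filter_upwards [hfpos] with x hx using abs_log_clampDensity_le hw hM hx
    · filter_upwards [hfpos] with x hx
      refine tendsto_const_nhds.congr' ?_
      filter_upwards [tendsto_clampDensity hw hx] with M hM
      rw [hM]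
  have hlim2 : Tendsto (fun M => Real.exp (-M) * ∫ x, laplaceSmooth μ x) atTop (𝓝 0) := by
    simpa using (Real.tendsto_exp_neg_atTop_nhds_zero).mul_const (∫ x, laplaceSmooth μ x)
  obtain ⟨M, hM0, hM1, hM2⟩ := ((eventually_ge_atTop (0:ℝ)).and
    ((hlim2.eventually_le_const hη).and (hlim.eventually_const_le
      (show ∫ x, Real.log (f x) ∂μ - η < ∫ x, Real.log (f x) ∂μ by linarith)))).exists
  have hbd : Integrable fun x => f x + Real.exp (-M) * laplaceSmooth μ x :=
    hf.add (hwi.const_mul _)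
  have hgi : Integrable (clampDensity f (laplaceSmooth μ) M) :=
    hbd.mono' (measurable_clampDensity hfm hwm).aestronglyMeasurable
      (Eventually.of_forall fun x => by
        rw [Real.norm_eq_abs, abs_of_pos (clampDensity_pos hw x)]; exact clampDensity_le hf0 hw x)
  refine ⟨clampDensity f (laplaceSmooth μ) M, fun x => Real.log (laplaceSmooth μ x), M,
    measurable_clampDensity hfm hwm, clampDensity_pos hw, hgi, ?_, hwm.log,
    abs_log_clampDensity_sub_le hw hM0, log_laplaceSmooth_sub_le μ, hlogw, hM2⟩
  have := integral_mono hgi hbd (clampDensity_le hf0 hw)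
  rw [integral_add hf (hwi.const_mul _), integral_density hfm hf0 hμf, integral_const_mul] at this
  linarith

/-- The law with density `genGauss r`. -/
def genGaussLaw (r : ℝ) : Measure ℝ := volume.withDensity fun z => ENNReal.ofReal (genGauss r z)

lemma isProbabilityMeasure_genGaussLaw {r : ℝ} (hr : 0 < r) :
    IsProbabilityMeasure (genGaussLaw r) := by
  constructor
  rw [genGaussLaw, withDensity_apply _ MeasurableSet.univ, Measure.restrict_univ,
    ← ofReal_integral_eq_lintegral_ofReal (integrable_genGauss hr)
      (Eventually.of_forall fun z => (genGauss_pos hr z).le), integral_genGauss hr,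
    ENNReal.ofReal_one]

lemma integrable_abs_rpow_genGaussLaw {r q : ℝ} (hr : 0 < r) (hq : -1 < q) :
    Integrable (fun z => |z| ^ q) (genGaussLaw r) := by
  rw [genGaussLaw, integrable_iff_of_density (measurable_genGauss r)
    (fun z => (genGauss_pos hr z).le) rfl]
  simpa only [mul_comm] using integrable_abs_rpow_mul_genGauss hr hq

lemma integral_abs_rpow_genGaussLaw {r : ℝ} (hr : 0 < r) :
    ∫ z, |z| ^ r ∂(genGaussLaw r) = 1 := by
  rw [genGaussLaw, integral_eq_of_density (measurable_genGauss r)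
    (fun z => (genGauss_pos hr z).le) rfl]
  simpa only [mul_comm] using integral_abs_rpow_self_mul_genGauss hr

section logdensity
variable {μ γ : Measure ℝ} [IsProbabilityMeasure μ] [IsProbabilityMeasure γ]
  {g w : ℝ → ℝ} {K : ℝ}

lemma integrable_log_density_add_mul (hg : Measurable g) (hw : Measurable w)
    (hgw : ∀ x, |Real.log (g x) - w x| ≤ K) (hlip : ∀ x y, w x - |y - x| ≤ w y)
    (hwi : Integrable w μ) (hγ : Integrable (fun z => |z|) γ) (ε : ℝ) :
    Integrable (fun p : ℝ × ℝ => Real.log (g (p.1 + ε * p.2))) (μ.prod γ) ∧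
      Integrable (fun p : ℝ × ℝ => w (p.1 + ε * p.2)) (μ.prod γ) := by
  have hw1 : Integrable (fun p : ℝ × ℝ => w p.1) (μ.prod γ) := hwi.comp_fst γ
  have hz1 : Integrable (fun p : ℝ × ℝ => |p.2|) (μ.prod γ) := hγ.comp_snd μ
  have h1 : Integrable (fun p : ℝ × ℝ => w (p.1 + ε * p.2)) (μ.prod γ) := by
    refine (hw1.abs.add (hz1.const_mul |ε|)).mono'
      (by apply Measurable.aestronglyMeasurable; fun_prop) (Eventually.of_forall fun p => ?_)
    have a1 := hlip p.1 (p.1 + ε * p.2)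
    have a2 := hlip (p.1 + ε * p.2) p.1
    have e1 : |p.1 + ε * p.2 - p.1| = |ε| * |p.2| := by rw [add_sub_cancel_left, abs_mul]
    have e2 : |p.1 - (p.1 + ε * p.2)| = |ε| * |p.2| := by rw [abs_sub_comm, e1]
    rw [e1] at a1; rw [e2] at a2
    have := le_abs_self (w p.1); have := neg_le_abs (w p.1)
    simp only [Pi.add_apply]
    rw [Real.norm_eq_abs, abs_le]; constructor <;> linarith
  refine ⟨?_, h1⟩
  have h2 : Integrable (fun p : ℝ × ℝ => Real.log (g (p.1 + ε * p.2)) - w (p.1 + ε * p.2))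
      (μ.prod γ) := Integrable.of_bound (C := K)
        (by apply Measurable.aestronglyMeasurable; fun_prop)
        (Eventually.of_forall fun p => hgw _)
  exact (h2.add h1).congr (Eventually.of_forall fun p => by simp)

lemma eventually_integral_log_density_le {f : ℝ → ℝ} (hfm : Measurable f) (hf0 : ∀ x, 0 ≤ f x)
    (hμf : μ = volume.withDensity fun x => ENNReal.ofReal (f x)) (hg : Measurable g)
    (hw : Measurable w)
    (hgw : ∀ x, |Real.log (g x) - w x| ≤ K) (hlip : ∀ x y, w x - |y - x| ≤ w y)
    (hwi : Integrable w μ) (hγ : Integrable (fun z => |z|) γ) {η : ℝ} (hη : 0 < η) :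
    ∀ᶠ ε : ℝ in 𝓝[>] 0, ∫ x, Real.log (g x) ∂μ - η
      ≤ ∫ p, Real.log (g (p.1 + ε * p.2)) ∂(μ.prod γ) := by
  have hT := tendsto_integral_prod_add_mul hfm hf0 hμf γ (hg.log.sub hw) hgw
  have hε : Tendsto (fun ε : ℝ => |ε| * ∫ z, |z| ∂γ) (𝓝[>] 0) (𝓝 0) := by
    have : Tendsto (fun ε : ℝ => |ε| * ∫ z, |z| ∂γ) (𝓝 0) (𝓝 0) := by
      simpa using (continuous_abs.mul_const (∫ z, |z| ∂γ)).tendsto (0:ℝ)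
    exact this.mono_left nhdsWithin_le_nhds
  have hTi : Integrable (fun x => Real.log (g x) - w x) μ :=
    Integrable.of_bound (C := K) (hg.log.sub hw).aestronglyMeasurable (Eventually.of_forall hgw)
  have hlg : ∫ x, Real.log (g x) ∂μ = ∫ x, (Real.log (g x) - w x) ∂μ + ∫ x, w x ∂μ := by
    rw [← integral_add hTi hwi]; simp
  filter_upwards [hT.eventually_const_le (show ∫ x, (Real.log (g x) - w x) ∂μ - η / 2
    < ∫ x, (Real.log (g x) - w x) ∂μ by linarith),
    hε.eventually_le_const (show 0 < η / 2 by positivity)] with ε h1 h2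
  obtain ⟨i1, i2⟩ := integrable_log_density_add_mul hg hw hgw hlip hwi hγ ε
  have e : ∫ p, Real.log (g (p.1 + ε * p.2)) ∂(μ.prod γ)
      = ∫ p, (Real.log (g (p.1 + ε * p.2)) - w (p.1 + ε * p.2)) ∂(μ.prod γ)
        + ∫ p, w (p.1 + ε * p.2) ∂(μ.prod γ) := by
    rw [integral_sub i1 i2]; ring
  have hw1 : Integrable (fun p : ℝ × ℝ => w p.1) (μ.prod γ) := hwi.comp_fst γ
  have hz1 : Integrable (fun p : ℝ × ℝ => |p.2|) (μ.prod γ) := hγ.comp_snd μ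
  have h3 : ∫ p, (w p.1 - |ε| * |p.2|) ∂(μ.prod γ) ≤ ∫ p, w (p.1 + ε * p.2) ∂(μ.prod γ) := by
    refine integral_mono (hw1.sub (hz1.const_mul _)) i2 fun p => ?_
    have a1 := hlip p.1 (p.1 + ε * p.2)
    rwa [add_sub_cancel_left, abs_mul] at a1
  rw [integral_sub hw1 (hz1.const_mul _), integral_const_mul, integral_fun_fst (μ := μ) (ν := γ) w,
    integral_fun_snd (μ := μ) (ν := γ) (fun z => |z|)] at h3
  simp only [probReal_univ, one_smul] at h3
  simp only [Pi.sub_apply] at h1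
  linarith

end logdensity

lemma lintegral_comp_add_mul (x : ℝ) {ε : ℝ} (hε : 0 < ε) {h : ℝ → ℝ≥0∞} (hh : Measurable h) :
    ∫⁻ z, h (x + ε * z) = ∫⁻ y, h y * ENNReal.ofReal ε⁻¹ := by
  have h1 : ∫⁻ y, h y = ∫⁻ y, h (x + y) := (lintegral_add_left_eq_self h x).symm
  rw [lintegral_mul_const _ hh, h1]
  nth_rewrite 2 [← Real.smul_map_volume_mul_left hε.ne']
  rw [lintegral_smul_measure, lintegral_map (by fun_prop) (by fun_prop), abs_of_pos hε, smul_eq_mul,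
    mul_comm, ← mul_assoc, ← ENNReal.ofReal_mul (by positivity), inv_mul_cancel₀ hε.ne']
  simp

/-- The joint law of `X` and `X + ε Z` with independent generalized Gaussian `Z`. -/
def noisyLaw (μ : Measure ℝ) (r ε : ℝ) : Measure (ℝ × ℝ) :=
  (μ.prod (genGaussLaw r)).map fun p => (p.1, p.1 + ε * p.2)

/-- The channel adding independent generalized Gaussian noise. -/
def noiseKernel (r ε : ℝ) : ProbabilityTheory.Kernel ℝ ℝ :=
  (ProbabilityTheory.Kernel.id ×ₖ ProbabilityTheory.Kernel.const ℝ (genGaussLaw r)).map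
    fun p => p.1 + ε * p.2

/-- The conditional density of `X + ε Z` given `X = x`. -/
def noiseDensity (r ε x y : ℝ) : ℝ := genGauss r ((y - x) / ε) * ε⁻¹

/-- The density of `X + ε Z`. -/
def outputDensity (μ : Measure ℝ) (r ε y : ℝ) : ℝ := ∫ x, noiseDensity r ε x y ∂μ

section channel
variable {μ : Measure ℝ} {r ε : ℝ}

lemma isMarkovKernel_noiseKernel (hr : 0 < r) :
    ProbabilityTheory.IsMarkovKernel (noiseKernel r ε) := by
  have := isProbabilityMeasure_genGaussLaw hr
  exact ProbabilityTheory.Kernel.IsMarkovKernel.map _ (by fun_prop)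

lemma lintegral_noisyLaw (hr : 0 < r) {h : ℝ × ℝ → ℝ≥0∞} (hh : Measurable h) :
    ∫⁻ p, h p ∂(noisyLaw μ r ε) = ∫⁻ x, ∫⁻ z, h (x, x + ε * z) ∂(genGaussLaw r) ∂μ := by
  have := isProbabilityMeasure_genGaussLaw hr
  rw [noisyLaw, lintegral_map hh (by fun_prop), lintegral_prod _ (by fun_prop)]

lemma map_fst_noisyLaw (hr : 0 < r) : (noisyLaw μ r ε).map Prod.fst = μ := by
  have := isProbabilityMeasure_genGaussLaw hr
  rw [noisyLaw, Measure.map_map measurable_fst (by fun_prop)]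
  exact Measure.map_fst_prod.trans (by simp)

lemma noiseDensity_pos (hr : 0 < r) (hε : 0 < ε) (x y : ℝ) : 0 < noiseDensity r ε x y :=
  mul_pos (genGauss_pos hr _) (by positivity)

lemma measurable_noiseDensity : Measurable fun p : ℝ × ℝ => noiseDensity r ε p.1 p.2 := by
  have := measurable_genGauss r
  unfold noiseDensity; fun_prop

lemma measurable_noiseDensity_left (y : ℝ) : Measurable fun x => noiseDensity r ε x y := by
  have := measurable_genGauss r
  unfold noiseDensity; fun_prop

lemma lintegral_noisyLaw_eq_density (hr : 0 < r) (hε : 0 < ε) {h : ℝ × ℝ → ℝ≥0∞}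
    (hh : Measurable h) :
    ∫⁻ p, h p ∂(noisyLaw μ r ε)
      = ∫⁻ x, ∫⁻ y, h (x, y) * ENNReal.ofReal (noiseDensity r ε x y) ∂volume ∂μ := by
  rw [lintegral_noisyLaw hr hh]
  congr 1; ext x
  have hG' := measurable_genGauss r
  have hG := hG'.ennreal_ofReal
  rw [genGaussLaw, lintegral_withDensity_eq_lintegral_mul _ hG (by fun_prop)]
  have := lintegral_comp_add_mul x hε
    (h := fun y => h (x, y) * ENNReal.ofReal (genGauss r ((y - x) / ε))) (by fun_prop)
  simp only [add_sub_cancel_left, mul_div_cancel_left₀ _ hε.ne'] at this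
  simp only [Pi.mul_apply]
  simp_rw [mul_comm (ENNReal.ofReal (genGauss r _))]
  rw [this]
  congr 1; ext y
  rw [mul_assoc, ← ENNReal.ofReal_mul (genGauss_pos hr _).le, noiseDensity]

variable [IsProbabilityMeasure μ]

lemma integrable_noiseDensity (hr : 0 < r) (hε : 0 < ε) (y : ℝ) :
    Integrable (fun x => noiseDensity r ε x y) μ := by
  refine Integrable.of_bound (C := 1 / genGaussConst r * ε⁻¹)
    (measurable_noiseDensity_left y).aestronglyMeasurable
    (Eventually.of_forall fun x => ?_)
  rw [Real.norm_eq_abs, abs_of_pos (noiseDensity_pos hr hε x y), noiseDensity, genGauss]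
  have := genGaussConst_pos hr
  gcongr
  exact Real.exp_le_one_iff.2 (by simp; positivity)

lemma outputDensity_pos (hr : 0 < r) (hε : 0 < ε) (y : ℝ) : 0 < outputDensity μ r ε y := by
  rw [outputDensity, integral_pos_iff_support_of_nonneg
    (fun x => (noiseDensity_pos hr hε x y).le) (integrable_noiseDensity hr hε y)]
  have : (Function.support fun x : ℝ => noiseDensity r ε x y) = univ := by
    ext x; simp [(noiseDensity_pos hr hε x y).ne']
  simp [this]

lemma measurable_outputDensity : Measurable (outputDensity μ r ε) :=
  (StronglyMeasurable.integral_prod_right (ν := μ)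
    (f := fun y x => noiseDensity r ε x y)
    (measurable_noiseDensity.comp measurable_swap).stronglyMeasurable).measurable

lemma compProd_noiseKernel (hr : 0 < r) : μ.compProd (noiseKernel r ε) = noisyLaw μ r ε := by
  have := isProbabilityMeasure_genGaussLaw hr
  have := isMarkovKernel_noiseKernel (ε := ε) hr
  ext s hs
  rw [← lintegral_indicator_one hs, ← lintegral_indicator_one hs,
    Measure.lintegral_compProd (measurable_one.indicator hs),
    lintegral_noisyLaw hr (measurable_one.indicator hs)]
  congr 1; ext x
  have hm : Measurable fun y => s.indicator (1 : ℝ × ℝ → ℝ≥0∞) (x, y) :=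
    (measurable_one.indicator hs).comp (by fun_prop)
  rw [noiseKernel, ProbabilityTheory.Kernel.map_apply _ (by fun_prop),
    ProbabilityTheory.Kernel.prod_apply, ProbabilityTheory.Kernel.id_apply,
    ProbabilityTheory.Kernel.const_apply, Measure.dirac_prod, lintegral_map hm (by fun_prop),
    lintegral_map (by fun_prop) (by fun_prop)]

lemma map_snd_noisyLaw (hr : 0 < r) (hε : 0 < ε) : (noisyLaw μ r ε).map Prod.snd
    = volume.withDensity fun y => ENNReal.ofReal (outputDensity μ r ε y) := by
  ext s hs
  have hm := (measurable_noiseDensity (r := r) (ε := ε)).ennreal_ofReal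
  have hi : Measurable fun y => s.indicator (1 : ℝ → ℝ≥0∞) y := measurable_one.indicator hs
  have hmeas : Measurable (Function.uncurry fun x y =>
      s.indicator (1 : ℝ → ℝ≥0∞) y * ENNReal.ofReal (noiseDensity r ε x y)) :=
    (hi.comp measurable_snd).mul hm
  calc ((noisyLaw μ r ε).map Prod.snd) s
      = ∫⁻ y, s.indicator (1 : ℝ → ℝ≥0∞) y ∂((noisyLaw μ r ε).map Prod.snd) :=
        (lintegral_indicator_one hs).symm
    _ = ∫⁻ p, s.indicator (1 : ℝ → ℝ≥0∞) p.2 ∂(noisyLaw μ r ε) :=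
        lintegral_map hi measurable_snd
    _ = ∫⁻ x, ∫⁻ y, s.indicator (1 : ℝ → ℝ≥0∞) y * ENNReal.ofReal (noiseDensity r ε x y)
          ∂volume ∂μ := lintegral_noisyLaw_eq_density hr hε (hi.comp measurable_snd)
    _ = ∫⁻ y, ∫⁻ x, s.indicator (1 : ℝ → ℝ≥0∞) y * ENNReal.ofReal (noiseDensity r ε x y)
          ∂μ ∂volume := lintegral_lintegral_swap hmeas.aemeasurable
    _ = ∫⁻ y, s.indicator (fun y => ENNReal.ofReal (outputDensity μ r ε y)) y := by
        refine lintegral_congr fun y => ?_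
        have hmy : Measurable fun x => ENNReal.ofReal (noiseDensity r ε x y) :=
          (measurable_noiseDensity_left y).ennreal_ofReal
        have e : ∫⁻ x, ENNReal.ofReal (noiseDensity r ε x y) ∂μ
            = ENNReal.ofReal (outputDensity μ r ε y) :=
          (ofReal_integral_eq_lintegral_ofReal (integrable_noiseDensity hr hε y)
            (Eventually.of_forall fun x => (noiseDensity_pos hr hε x y).le)).symm
        rw [lintegral_const_mul _ hmy, e]
        by_cases hy : y ∈ s <;> simp [hy]
    _ = _ := by rw [withDensity_apply _ hs, lintegral_indicator hs]

lemma noisyLaw_eq_withDensity (hr : 0 < r) (hε : 0 < ε) :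
    noisyLaw μ r ε = (μ.prod ((noisyLaw μ r ε).map Prod.snd)).withDensity
      fun p => ENNReal.ofReal (noiseDensity r ε p.1 p.2 / outputDensity μ r ε p.2) := by
  have hm := (measurable_noiseDensity (r := r) (ε := ε))
  have hq := measurable_outputDensity (μ := μ) (r := r) (ε := ε)
  have : SFinite ((noisyLaw μ r ε).map Prod.snd) := by
    rw [map_snd_noisyLaw hr hε]; infer_instance
  ext s hs
  have hi : Measurable fun y => s.indicator (1 : ℝ × ℝ → ℝ≥0∞) y := measurable_one.indicator hs
  rw [← lintegral_indicator_one hs, lintegral_noisyLaw_eq_density hr hε (by fun_prop),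
    withDensity_apply _ hs, ← lintegral_indicator hs, lintegral_prod _
      (by apply Measurable.aemeasurable; apply Measurable.indicator _ hs; fun_prop),
    map_snd_noisyLaw hr hε]
  congr 1; ext x
  have hi' : Measurable fun y => s.indicator
      (fun p => ENNReal.ofReal (noiseDensity r ε p.1 p.2 / outputDensity μ r ε p.2)) (x, y) :=
    (Measurable.indicator (by fun_prop) hs).comp measurable_prodMk_left
  rw [lintegral_withDensity_eq_lintegral_mul _ (by fun_prop) hi']
  congr 1; ext y
  have h1 := outputDensity_pos (μ := μ) hr hε y
  by_cases hy : (x, y) ∈ s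
  · simp only [Pi.mul_apply, indicator_of_mem hy, Pi.one_apply, one_mul]
    rw [← ENNReal.ofReal_mul h1.le, mul_div_cancel₀ _ h1.ne']
  · simp [hy]

end channel

lemma klDiv_ne_top_and_toReal_le_integral {α : Type*} [MeasurableSpace α] {π m : Measure α}
    [IsProbabilityMeasure π] [IsProbabilityMeasure m] {k U : α → ℝ} (hk : Measurable k)
    (hk0 : ∀ x, 0 < k x) (hπ : π = m.withDensity fun x => ENNReal.ofReal (k x))
    (hU : Integrable U π) (hkU : ∀ᵐ x ∂π, Real.log (k x) ≤ U x) :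
    klDiv π m ≠ ⊤ ∧ (klDiv π m).toReal ≤ ∫ x, U x ∂π := by
  have hac : π ≪ m := hπ ▸ withDensity_absolutelyContinuous _ _
  have hrn : (fun x => Real.log (π.rnDeriv m x).toReal) =ᵐ[π] fun x => Real.log (k x) := by
    have h1 : π.rnDeriv m =ᵐ[m] fun x => ENNReal.ofReal (k x) := by
      rw [hπ]; exact Measure.rnDeriv_withDensity m hk.ennreal_ofReal
    filter_upwards [hac.ae_le h1] with x hx
    rw [hx, ENNReal.toReal_ofReal (hk0 x).le]
  have hkm : Measurable fun x => (k x)⁻¹ := hk.inv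
  have hlin : ∫⁻ x, ENNReal.ofReal (k x)⁻¹ ∂π = 1 := by
    rw [hπ, lintegral_withDensity_eq_lintegral_mul _ hk.ennreal_ofReal hkm.ennreal_ofReal]
    have : ((fun x => ENNReal.ofReal (k x)) * fun x => ENNReal.ofReal (k x)⁻¹) = fun _ => 1 := by
      ext x
      rw [Pi.mul_apply, ← ENNReal.ofReal_mul (hk0 x).le, mul_inv_cancel₀ (hk0 x).ne',
        ENNReal.ofReal_one]
    rw [this]; simp
  have hki : Integrable (fun x => (k x)⁻¹) π := by
    refine ⟨hkm.aestronglyMeasurable, ?_⟩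
    rw [hasFiniteIntegral_iff_ofReal (Eventually.of_forall fun x => (inv_pos.2 (hk0 x)).le), hlin]
    exact ENNReal.one_lt_top
  have hk1 : ∫ x, (k x)⁻¹ ∂π = 1 := by
    rw [integral_eq_lintegral_of_nonneg_ae (Eventually.of_forall fun x => (inv_pos.2 (hk0 x)).le)
      hkm.aestronglyMeasurable, hlin, ENNReal.toReal_one]
  have hlow : ∀ x, 1 - (k x)⁻¹ ≤ Real.log (k x) := fun x =>
    Real.one_sub_inv_le_log_of_pos (hk0 x)
  have hLi : Integrable (fun x => Real.log (k x)) π := by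
    refine (((integrable_const 1).sub hki).abs.add hU.abs).mono' hk.log.aestronglyMeasurable ?_
    filter_upwards [hkU] with x hx
    simp only [Pi.add_apply, Pi.sub_apply]
    rw [Real.norm_eq_abs, abs_le]
    have := hlow x
    have := neg_le_abs (1 - (k x)⁻¹); have := le_abs_self (U x)
    have := abs_nonneg (1 - (k x)⁻¹); have := abs_nonneg (U x)
    constructor <;> linarith
  have hL0 : 0 ≤ ∫ x, Real.log (k x) ∂π := by
    have := integral_mono ((integrable_const 1).sub hki) hLi hlow
    rwa [integral_sub' (integrable_const 1) hki, hk1, integral_const, probReal_univ, one_smul,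
      sub_self] at this
  rw [klDiv, if_pos ⟨hac, hLi.congr hrn.symm⟩, integral_congr_ae hrn, ENNReal.toReal_ofReal hL0]
  exact ⟨ENNReal.ofReal_ne_top, integral_mono_ae hLi hU hkU⟩

section
variable {μ : Measure ℝ} [IsProbabilityMeasure μ] {r ε : ℝ}

lemma RDfun_toReal_le (hr : 0 < r) (hε : 0 < ε) {g : ℝ → ℝ} (hg : Measurable g)
    (hg0 : ∀ x, 0 < g x) (hgi : Integrable g)
    (hlg : Integrable (fun p : ℝ × ℝ => Real.log (g (p.1 + ε * p.2))) (μ.prod (genGaussLaw r))) :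
    (RDfun μ (fun x => |x|) r (ε ^ r)).toReal ≤
      -Real.log ε - Real.log (genGaussConst r) - 1 / r
        - ∫ p, Real.log (g (p.1 + ε * p.2)) ∂(μ.prod (genGaussLaw r)) + (∫ y, g y) - 1 := by
  have hγ := isProbabilityMeasure_genGaussLaw hr
  have hκ := isMarkovKernel_noiseKernel (ε := ε) hr
  have hT : Measurable fun p : ℝ × ℝ => (p.1, p.1 + ε * p.2) := by fun_prop
  set π := noisyLaw μ r ε with hπdef
  have hπ : IsProbabilityMeasure π := Measure.isProbabilityMeasure_map hT.aemeasurable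
  set ν := π.map Prod.snd with hν
  have hνp : IsProbabilityMeasure ν := Measure.isProbabilityMeasure_map measurable_snd.aemeasurable
  set o := outputDensity μ r ε with ho
  have ho0 : ∀ y, 0 < o y := outputDensity_pos hr hε
  have hom : Measurable o := measurable_outputDensity
  have hφm := measurable_noiseDensity (r := r) (ε := ε)
  have hφ0 := noiseDensity_pos (r := r) hr hε
  have hνd : ν = volume.withDensity fun y => ENNReal.ofReal (o y) := map_snd_noisyLaw hr hε
  have hzi : Integrable (fun p : ℝ × ℝ => |p.2| ^ r) (μ.prod (genGaussLaw r)) :=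
    (integrable_abs_rpow_genGaussLaw hr (by linarith)).comp_snd μ
  have hz1 : ∫ p : ℝ × ℝ, |p.2| ^ r ∂(μ.prod (genGaussLaw r)) = 1 := by
    rw [integral_fun_snd (μ := μ) (ν := genGaussLaw r) (fun z => |z| ^ r), probReal_univ, one_smul,
      integral_abs_rpow_genGaussLaw hr]
  have hdist : ∫⁻ p, ENNReal.ofReal (|p.1 - p.2| ^ r) ∂(μ.compProd (noiseKernel r ε))
      ≤ ENNReal.ofReal (ε ^ r) := by
    rw [compProd_noiseKernel hr, noisyLaw, lintegral_map (by fun_prop) hT]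
    have : ∀ p : ℝ × ℝ, |p.1 - (p.1 + ε * p.2)| ^ r = ε ^ r * |p.2| ^ r := fun p => by
      rw [sub_add_cancel_left, abs_neg, abs_mul, abs_of_pos hε,
        Real.mul_rpow hε.le (abs_nonneg _)]
    simp only [this]
    rw [← ofReal_integral_eq_lintegral_ofReal (hzi.const_mul _)
      (Eventually.of_forall fun p => by positivity), integral_const_mul, hz1, mul_one]
  have hle : RDfun μ (fun x => |x|) r (ε ^ r) ≤ klDiv π (μ.prod ν) := by
    refine (iInf_le_of_le (noiseKernel r ε) (iInf_le_of_le hκ (iInf_le _ hdist))).trans ?_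
    rw [mutualInfo, compProd_noiseKernel hr, map_fst_noisyLaw hr]
  have hgo : Integrable (fun p : ℝ × ℝ => g p.2 / o p.2) π ∧
      ∫ p, g p.2 / o p.2 ∂π = ∫ y, g y := by
    have e : ∀ y, o y * (g y / o y) = g y := fun y => mul_div_cancel₀ _ (ho0 y).ne'
    have hm : Measurable fun y => g y / o y := hg.div hom
    have h1 : Integrable (fun y => g y / o y) ν := by
      rw [integrable_iff_of_density hom (fun y => (ho0 y).le) hνd]
      simpa only [e] using hgi
    refine ⟨h1.comp_measurable measurable_snd, ?_⟩
    rw [← integral_map (f := fun y => g y / o y) measurable_snd.aemeasurable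
      hm.aestronglyMeasurable, integral_eq_of_density hom (fun y => (ho0 y).le) hνd]
    simp only [e]
  have hlφ : ∀ p : ℝ × ℝ, Real.log (noiseDensity r ε p.1 (p.1 + ε * p.2))
      = -(|p.2| ^ r / r + (Real.log (genGaussConst r) + Real.log ε)) := fun p => by
    rw [noiseDensity, Real.log_mul (genGauss_pos hr _).ne' (inv_pos.2 hε).ne', Real.log_inv,
      add_sub_cancel_left, mul_div_cancel_left₀ _ hε.ne', log_genGauss hr]
    ring
  have hB : Integrable (fun p : ℝ × ℝ =>
      -(|p.2| ^ r / r + (Real.log (genGaussConst r) + Real.log ε))) (μ.prod (genGaussLaw r)) :=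
    ((hzi.div_const r).add (integrable_const _)).neg
  have hVm : Measurable fun p : ℝ × ℝ =>
      Real.log (noiseDensity r ε p.1 p.2) - Real.log (g p.2) := by fun_prop
  have hVT : (fun p : ℝ × ℝ => Real.log (noiseDensity r ε p.1 p.2) - Real.log (g p.2))
      ∘ (fun p : ℝ × ℝ => (p.1, p.1 + ε * p.2)) = fun p =>
      -(|p.2| ^ r / r + (Real.log (genGaussConst r) + Real.log ε))
        - Real.log (g (p.1 + ε * p.2)) := by
    ext p; simp only [Function.comp_apply, hlφ]
  have hV : Integrable (fun p : ℝ × ℝ =>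
      Real.log (noiseDensity r ε p.1 p.2) - Real.log (g p.2)) π := by
    rw [hπdef, noisyLaw, integrable_map_measure hVm.aestronglyMeasurable hT.aemeasurable, hVT]
    exact hB.sub hlg
  have hVi : ∫ p, (Real.log (noiseDensity r ε p.1 p.2) - Real.log (g p.2)) ∂π
      = -Real.log ε - Real.log (genGaussConst r) - 1 / r
        - ∫ p, Real.log (g (p.1 + ε * p.2)) ∂(μ.prod (genGaussLaw r)) := by
    have : ∫ p, (Real.log (noiseDensity r ε p.1 p.2) - Real.log (g p.2)) ∂π
        = ∫ p : ℝ × ℝ, (-(|p.2| ^ r / r + (Real.log (genGaussConst r) + Real.log ε))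
          - Real.log (g (p.1 + ε * p.2))) ∂(μ.prod (genGaussLaw r)) := by
      rw [hπdef, noisyLaw, integral_map hT.aemeasurable hVm.aestronglyMeasurable, ← hVT]; rfl
    rw [this, integral_sub hB hlg, integral_neg, integral_add (hzi.div_const r)
      (integrable_const _), integral_div, hz1]
    simp only [integral_const, probReal_univ, one_smul]
    ring
  have hkU : ∀ p : ℝ × ℝ, Real.log (noiseDensity r ε p.1 p.2 / o p.2)
      ≤ Real.log (noiseDensity r ε p.1 p.2) - Real.log (g p.2) + (g p.2 / o p.2 - 1) := fun p => by
    have h1 := Real.log_le_sub_one_of_pos (div_pos (hg0 p.2) (ho0 p.2))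
    rw [Real.log_div (hg0 _).ne' (ho0 _).ne'] at h1
    rw [Real.log_div (hφ0 _ _).ne' (ho0 _).ne']
    linarith
  have hmain := klDiv_ne_top_and_toReal_le_integral (π := π) (m := μ.prod ν)
    (k := fun p => noiseDensity r ε p.1 p.2 / o p.2) (by fun_prop)
    (fun p => div_pos (hφ0 _ _) (ho0 _)) (noisyLaw_eq_withDensity hr hε)
    (hV.add (hgo.1.sub (integrable_const 1))) (Eventually.of_forall hkU)
  refine (ENNReal.toReal_mono hmain.1 hle).trans (hmain.2.trans_eq ?_)
  rw [integral_add' hV (hgo.1.sub (integrable_const 1)), hVi,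
    integral_sub' hgo.1 (integrable_const 1), hgo.2, integral_const, probReal_univ, one_smul]
  ring

/-- The upper half of the asymptotic tightness of the Shannon lower bound. -/
lemma eventually_RDfun_toReal_le (hr : 0 < r) {f : ℝ → ℝ} (hfm : Measurable f)
    (hf0 : ∀ x, 0 ≤ f x) (hμf : μ = volume.withDensity fun x => ENNReal.ofReal (f x))
    (hlogf : Integrable (fun x => Real.log (f x)) μ)
    (hfloor : Summable fun k : ℤ => Real.negMulLog (μ {x | ⌊x⌋ = k}).toReal)
    {η : ℝ} (hη : 0 < η) :
    ∀ᶠ ε : ℝ in 𝓝[>] 0, (RDfun μ (fun x => |x|) r (ε ^ r)).toReal ≤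
      -∫ x, Real.log (f x) ∂μ - Real.log ε - Real.log (genGaussConst r) - 1 / r + η := by
  have hγ := isProbabilityMeasure_genGaussLaw hr
  have hγ1 : Integrable (fun z => |z|) (genGaussLaw r) := by
    simpa using integrable_abs_rpow_genGaussLaw (q := 1) hr (by norm_num)
  obtain ⟨g, w, K, hg, hg0, hgi, hg1, hw, hgw, hlip, hwi, hlog⟩ :=
    exists_near_density hfm hf0 hμf hlogf hfloor (show 0 < η / 3 by positivity)
  filter_upwards [eventually_integral_log_density_le hfm hf0 hμf hg hw hgw hlip hwi hγ1
    (show 0 < η / 3 by positivity), self_mem_nhdsWithin] with ε h1 hε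
  have := RDfun_toReal_le hr hε hg hg0 hgi
    (integrable_log_density_add_mul hg hw hgw hlip hwi hγ1 ε).1
  linarith

end

lemma integral_abs_sub_rpow_Icc {r a : ℝ} (hr : 0 < r) (ha : 0 ≤ a) (c : ℝ) :
    ∫ x in Icc (c - a) (c + a), |x - c| ^ r = 2 * a * (2 * a / cellLength r) ^ r := by
  have hL := cellLength_pos hr
  have hc : Continuous fun x : ℝ => |x| ^ r := by fun_prop (disch := simp [hr.le])
  have h0 : ∫ x in (0:ℝ)..a, |x| ^ r = a ^ (r + 1) / (r + 1) := by
    rw [intervalIntegral.integral_congr (g := fun x => x ^ r), integral_rpow (by left; linarith),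
      Real.zero_rpow (by linarith), sub_zero]
    intro x hx
    rw [uIcc_of_le ha] at hx
    simp only [abs_of_nonneg hx.1]
  have h1 : ∫ x in (-a)..0, |x| ^ r = a ^ (r + 1) / (r + 1) := by
    rw [← h0]
    have := intervalIntegral.integral_comp_neg (a := -a) (b := 0) (fun x : ℝ => |x| ^ r)
    simpa using this
  rw [integral_Icc_eq_integral_Ioc, ← intervalIntegral.integral_of_le (by linarith),
    intervalIntegral.integral_comp_sub_right (fun x => |x| ^ r)]
  simp only [sub_sub_cancel_left, add_sub_cancel_left]
  rw [← intervalIntegral.integral_add_adjacent_intervals (hc.intervalIntegrable _ 0)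
    (hc.intervalIntegrable 0 _), h0, h1, Real.div_rpow (by positivity) hL.le, cellLength_rpow hr,
    Real.mul_rpow (by norm_num) ha, Real.rpow_add_one' ha (by linarith)]
  have := Real.rpow_pos_of_pos (show (0:ℝ) < 2 by norm_num) r
  field_simp
  ring

/-- Among sets of given length, the centered interval has the smallest `r`-th moment. -/
lemma mul_rpow_le_setIntegral_abs_sub_rpow {r c s : ℝ} (hr : 0 < r) {B : Set ℝ}
    (hB : MeasurableSet B) (hBs : ∀ x ∈ B, |x - c| ≤ s) :
    (volume B).toReal * ((volume B).toReal / cellLength r) ^ r ≤ ∫ x in B, |x - c| ^ r := by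
  set a := (volume B).toReal / 2 with ha
  have ha0 : 0 ≤ a := by positivity
  have hΛ : (volume B).toReal = 2 * a := by rw [ha]; ring
  set J := Icc (c - a) (c + a) with hJ
  have hc : Continuous fun x : ℝ => |x - c| ^ r - a ^ r := by fun_prop (disch := simp [hr.le])
  have hc' : Continuous fun x : ℝ => |x - c| ^ r := by fun_prop (disch := simp [hr.le])
  have hsub : B ⊆ Icc (c - s) (c + s) := fun x hx => by
    have := abs_le.1 (hBs x hx); constructor <;> linarith
  have hBfin : volume B ≠ ⊤ := ((measure_mono hsub).trans_lt measure_Icc_lt_top).ne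
  have i1 : IntegrableOn (fun x => |x - c| ^ r) B := (hc'.integrableOn_Icc).mono_set hsub
  have i2 : IntegrableOn (fun x => |x - c| ^ r) J := hc'.integrableOn_Icc
  have hk : ∫ x in J, (|x - c| ^ r - a ^ r) ≤ ∫ x in B, (|x - c| ^ r - a ^ r) := by
    rw [← integral_indicator measurableSet_Icc, ← integral_indicator hB]
    refine integral_mono ((integrable_indicator_iff measurableSet_Icc).2 hc.integrableOn_Icc)
      ((integrable_indicator_iff hB).2 (hc.integrableOn_Icc.mono_set hsub)) fun x => ?_
    by_cases hx : |x - c| ≤ a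
    · have hxJ : x ∈ J := by have := abs_le.1 hx; constructor <;> linarith
      have : |x - c| ^ r ≤ a ^ r := Real.rpow_le_rpow (abs_nonneg _) hx hr.le
      rw [indicator_of_mem hxJ]
      by_cases hxB : x ∈ B <;> simp [hxB, this]
    · have hxJ : x ∉ J := fun h => hx (abs_le.2 ⟨by linarith [h.1], by linarith [h.2]⟩)
      have : a ^ r ≤ |x - c| ^ r := Real.rpow_le_rpow ha0 (not_le.1 hx).le hr.le
      rw [indicator_of_notMem hxJ]
      by_cases hxB : x ∈ B <;> simp [hxB, this]
  rw [integral_sub i1 (integrableOn_const hBfin), integral_sub i2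
    (integrableOn_const measure_Icc_lt_top.ne), integral_abs_sub_rpow_Icc hr ha0,
    setIntegral_const, setIntegral_const] at hk
  have hJv : volume.real J = 2 * a := by
    rw [hJ, Real.volume_real_Icc_of_le (by linarith)]; ring
  have hBv : volume.real B = 2 * a := hΛ
  rw [hJv, hBv] at hk
  rw [hΛ]
  linarith

lemma volume_toReal_div_cellLength_le {r c s : ℝ} (hr : 0 < r) (hs : 0 ≤ s) {B : Set ℝ}
    (hBs : ∀ x ∈ B, |x - c| ≤ s) : (volume B).toReal / cellLength r ≤ s := by
  have hsub : B ⊆ Icc (c - s) (c + s) := fun x hx => by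
    have := abs_le.1 (hBs x hx); constructor <;> linarith
  have h1 : (volume B).toReal ≤ 2 * s := by
    have := ENNReal.toReal_mono (measure_Icc_lt_top (μ := volume)).ne (measure_mono hsub)
    rw [Real.volume_Icc, ENNReal.toReal_ofReal (by linarith)] at this
    linarith
  have h2 : 1 ≤ (1 + r) ^ (1 / r) := Real.one_le_rpow (by linarith) (by positivity)
  rw [div_le_iff₀ (cellLength_pos hr), cellLength]
  nlinarith

lemma setIntegral_mul_le_of_abs_sub_le {r c s γ : ℝ} (hr : 0 < r) (hs : 0 ≤ s) (hγ : 0 ≤ γ)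
    {B : Set ℝ} (hB : MeasurableSet B) (hBs : ∀ x ∈ B, |x - c| ≤ s) {f g Ω : ℝ → ℝ}
    (hf : Integrable f) (hg : Integrable g) (hΩ : Integrable Ω)
    (hgΩ : ∀ x ∈ B, |g x - γ| ≤ Ω x) :
    ∫ x in B, (((volume B).toReal / cellLength r) ^ r - |x - c| ^ r) * f x
      ≤ ∫ x in B, s ^ r * (|f x - g x| + Ω x) := by
  have hL := cellLength_pos hr
  set m := ((volume B).toReal / cellLength r) ^ r with hm
  have hm0 : 0 ≤ m := by positivity
  have hms : m ≤ s ^ r :=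
    Real.rpow_le_rpow (by positivity) (volume_toReal_div_cellLength_le hr hs hBs) hr.le
  have hc' : Continuous fun x : ℝ => |x - c| ^ r := by fun_prop (disch := simp [hr.le])
  have hsub : B ⊆ Icc (c - s) (c + s) := fun x hx => by
    have := abs_le.1 (hBs x hx); constructor <;> linarith
  have hBfin : volume B ≠ ⊤ := ((measure_mono hsub).trans_lt measure_Icc_lt_top).ne
  have i1 : IntegrableOn (fun x => |x - c| ^ r) B := (hc'.integrableOn_Icc).mono_set hsub
  have i0 : IntegrableOn (fun _ => m) B := integrableOn_const hBfin
  have i2 : IntegrableOn (fun x => m - |x - c| ^ r) B := i0.sub i1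
  have hk : ∀ x ∈ B, |m - |x - c| ^ r| ≤ s ^ r := fun x hx => by
    have h1 := Real.rpow_le_rpow (abs_nonneg _) (hBs x hx) hr.le
    have h2 : 0 ≤ |x - c| ^ r := by positivity
    rw [abs_le]; constructor <;> linarith
  have hk0 : ∫ x in B, (m - |x - c| ^ r) ≤ 0 := by
    rw [integral_sub i0 i1, setIntegral_const, smul_eq_mul]
    have := mul_rpow_le_setIntegral_abs_sub_rpow hr hB hBs
    simp only [Measure.real]
    linarith
  have i3 : IntegrableOn (fun x => (m - |x - c| ^ r) * f x) B :=
    (hf.integrableOn (s := B)).bdd_mul (c := s ^ r) i2.aestronglyMeasurable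
      ((ae_restrict_iff' hB).2 (Eventually.of_forall hk))
  have i4 : IntegrableOn (fun x => s ^ r * (|f x - g x| + Ω x)) B :=
    (((hf.sub hg).abs.add hΩ).const_mul _).integrableOn
  calc ∫ x in B, (m - |x - c| ^ r) * f x
      ≤ ∫ x in B, (s ^ r * (|f x - g x| + Ω x) + γ * (m - |x - c| ^ r)) := by
        refine setIntegral_mono_on i3 (i4.add (i2.const_mul γ)) hB fun x hx => ?_
        have h1 : (m - |x - c| ^ r) * (f x - γ) ≤ s ^ r * (|f x - g x| + Ω x) := by
          refine (le_abs_self _).trans ?_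
          rw [abs_mul]
          refine mul_le_mul (hk x hx) ?_ (abs_nonneg _) (by positivity)
          have := abs_sub_le (f x) (g x) γ
          linarith [hgΩ x hx]
        linarith
    _ = (∫ x in B, s ^ r * (|f x - g x| + Ω x)) + γ * ∫ x in B, (m - |x - c| ^ r) := by
        rw [integral_add i4 (i2.const_mul γ), integral_const_mul γ]
    _ ≤ _ := by nlinarith

/-- The length of the part of the cell `I⁻¹ {i}` within distance `s` of `c i`. -/
def truncCellLength (I : ℝ → ℤ) (c : ℤ → ℝ) (s : ℝ) (i : ℤ) : ℝ :=
  (volume {x | I x = i ∧ |x - c i| ≤ s}).toReal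

section cells
variable {I : ℝ → ℤ} {c : ℤ → ℝ} {s : ℝ}

lemma measurableSet_truncCell (hI : Measurable I) (i : ℤ) :
    MeasurableSet {x | I x = i ∧ |x - c i| ≤ s} :=
  (hI (measurableSet_singleton i)).inter
    (measurableSet_le (f := fun x => |x - c i|) (by fun_prop) measurable_const)

lemma measurable_comp_index (hI : Measurable I) (a : ℤ → ℝ) : Measurable fun x => a (I x) :=
  (measurable_from_top (f := a)).comp hI

lemma measurableSet_abs_sub_le (hI : Measurable I) :
    MeasurableSet {x | |x - c (I x)| ≤ s} := by
  have := measurable_comp_index hI c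
  exact measurableSet_le (f := fun x => |x - c (I x)|) (by fun_prop) measurable_const

lemma iUnion_truncCell : ⋃ i, {x | I x = i ∧ |x - c i| ≤ s} = {x | |x - c (I x)| ≤ s} := by
  ext x; simp

lemma pairwise_disjoint_truncCell :
    Pairwise (Function.onFun Disjoint fun i => {x | I x = i ∧ |x - c i| ≤ s}) := by
  intro i j hij
  rw [Function.onFun, Set.disjoint_left]
  rintro x ⟨h1, -⟩ ⟨h2, -⟩
  exact hij (h1.symm.trans h2)

lemma truncCellLength_nonneg (i : ℤ) : 0 ≤ truncCellLength I c s i := ENNReal.toReal_nonneg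

lemma truncCellLength_div_le {r : ℝ} (hr : 0 < r) (hs : 0 ≤ s) (i : ℤ) :
    truncCellLength I c s i / cellLength r ≤ s :=
  volume_toReal_div_cellLength_le hr hs fun _ hx => hx.2

lemma abs_truncCellLength_rpow_sub_le {r : ℝ} (hr : 0 < r) (hs : 0 ≤ s) {x : ℝ}
    (hx : |x - c (I x)| ≤ s) :
    |(truncCellLength I c s (I x) / cellLength r) ^ r - |x - c (I x)| ^ r| ≤ s ^ r := by
  have hL := cellLength_pos hr
  have h0 : 0 ≤ truncCellLength I c s (I x) / cellLength r :=
    div_nonneg (truncCellLength_nonneg _) hL.le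
  have h1 := Real.rpow_le_rpow (abs_nonneg _) hx hr.le
  have h2 := Real.rpow_le_rpow h0 (truncCellLength_div_le (I := I) (c := c) hr hs (I x)) hr.le
  have h3 : 0 ≤ |x - c (I x)| ^ r := by positivity
  have h4 := Real.rpow_nonneg h0 r
  rw [abs_le]; constructor <;> linarith

end cells

/-- At small scales, the cell of given length with the smallest distortion is an interval,
uniformly over all partitions. -/
lemma exists_forall_setIntegral_truncCellLength_le {r : ℝ} (hr : 0 < r) {f : ℝ → ℝ}
    (hf : Integrable f) (hf0 : ∀ x, 0 ≤ f x) {η : ℝ} (hη : 0 < η) :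
    ∃ s₀ > 0, ∀ s, 0 ≤ s → s ≤ s₀ → ∀ (I : ℝ → ℤ) (c : ℤ → ℝ), Measurable I →
      ∫ x in {x | |x - c (I x)| ≤ s},
        ((truncCellLength I c s (I x) / cellLength r) ^ r - |x - c (I x)| ^ r) * f x
          ≤ s ^ r * η := by
  obtain ⟨g, hgc, hgη, hgcont, hgi⟩ :=
    hf.exists_hasCompactSupport_integral_sub_le (show 0 < η / 2 by positivity)
  obtain ⟨R, hR⟩ := hgc.isCompact.isBounded.subset_closedBall 0
  set N := Icc (-(|R| + 1)) (|R| + 1) with hN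
  have hNv : volume.real N = 2 * (|R| + 1) := by
    rw [hN, Real.volume_real_Icc_of_le (by linarith [abs_nonneg R])]; ring
  have hNpos : 0 < 2 * (|R| + 1) := by positivity
  set ω := η / 2 / (2 * (|R| + 1)) with hω
  have hω0 : 0 < ω := by positivity
  obtain ⟨d, hd, hdω⟩ := Metric.uniformContinuous_iff.1
    (hgc.uniformContinuous_of_continuous hgcont) ω hω0
  refine ⟨min (d / 3) (1 / 2), by positivity, fun s hs hs0 I c hI => ?_⟩
  have hsd : 2 * s < d := by linarith [hs0.trans (min_le_left _ _)]
  have hs1 : 2 * s ≤ 1 := by linarith [hs0.trans (min_le_right _ _)]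
  have hci := measurable_comp_index hI c
  have hti := measurable_comp_index hI fun i => (truncCellLength I c s i / cellLength r) ^ r
  have hΩ : Integrable (N.indicator fun _ => ω) :=
    (integrable_indicator_iff measurableSet_Icc).2 (integrableOn_const measure_Icc_lt_top.ne)
  have hfg : Integrable fun x => |f x - (|g x|)| := (hf.sub hgi.abs).abs
  have hΨ : Integrable fun x => s ^ r * (|f x - (|g x|)| + N.indicator (fun _ => ω) x) :=
    (hfg.add hΩ).const_mul _
  have hΨ0 : ∀ x, 0 ≤ s ^ r * (|f x - (|g x|)| + N.indicator (fun _ => ω) x) := fun x => by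
    have : 0 ≤ N.indicator (fun _ => ω) x := indicator_nonneg (fun _ _ => hω0.le) x
    positivity
  have hB := measurableSet_abs_sub_le (c := c) (s := s) hI
  have hF : IntegrableOn (fun x => ((truncCellLength I c s (I x) / cellLength r) ^ r
      - |x - c (I x)| ^ r) * f x) {x | |x - c (I x)| ≤ s} :=
    (hf.integrableOn).bdd_mul (c := s ^ r) (by apply Measurable.aestronglyMeasurable; fun_prop)
      ((ae_restrict_iff' hB).2 (Eventually.of_forall fun x hx =>
        abs_truncCellLength_rpow_sub_le hr hs hx))
  have key : ∫ x in {x | |x - c (I x)| ≤ s},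
      ((truncCellLength I c s (I x) / cellLength r) ^ r - |x - c (I x)| ^ r) * f x
      ≤ ∫ x in {x | |x - c (I x)| ≤ s}, s ^ r * (|f x - (|g x|)| + N.indicator (fun _ => ω) x) := by
    rw [← iUnion_truncCell] at hF ⊢
    refine hasSum_le (fun i => ?_) (hasSum_integral_iUnion (fun i => measurableSet_truncCell hI i)
      pairwise_disjoint_truncCell hF) (hasSum_integral_iUnion
        (fun i => measurableSet_truncCell hI i) pairwise_disjoint_truncCell hΨ.integrableOn)
    have e : ∫ x in {x | I x = i ∧ |x - c i| ≤ s},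
        ((truncCellLength I c s (I x) / cellLength r) ^ r - |x - c (I x)| ^ r) * f x
        = ∫ x in {x | I x = i ∧ |x - c i| ≤ s},
        ((truncCellLength I c s i / cellLength r) ^ r - |x - c i| ^ r) * f x :=
      setIntegral_congr_fun (measurableSet_truncCell hI i) fun x hx => by simp only [hx.1]
    rw [e]
    by_cases hemp : ∃ x₀ ∈ {x | I x = i ∧ |x - c i| ≤ s}, g x₀ ≠ 0
    · obtain ⟨x₀, hx₀, hgx⟩ := hemp
      refine setIntegral_mul_le_of_abs_sub_le (γ := |g x₀|) hr hs (abs_nonneg _)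
        (measurableSet_truncCell hI i) (fun x hx => hx.2) hf hgi.abs hΩ fun x hx => ?_
      have h1 := abs_le.1 hx₀.2
      have h2 := abs_le.1 hx.2
      have h3 : |x - x₀| ≤ 2 * s := by rw [abs_le]; constructor <;> linarith
      have h4 := hR (subset_tsupport _ hgx)
      rw [mem_closedBall_zero_iff, Real.norm_eq_abs] at h4
      have h5 := abs_le.1 (h4.trans (le_abs_self R))
      have h6 := abs_le.1 h3
      have hxN : x ∈ N := by constructor <;> linarith
      rw [indicator_of_mem hxN]
      exact (abs_abs_sub_abs_le _ _).trans (hdω (h3.trans_lt hsd)).le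
    · push Not at hemp
      refine setIntegral_mul_le_of_abs_sub_le (γ := 0) hr hs le_rfl
        (measurableSet_truncCell hI i) (fun x hx => hx.2) hf hgi.abs hΩ fun x hx => ?_
      rw [hemp x hx, abs_zero, sub_zero, abs_zero]
      exact indicator_nonneg (fun _ _ => hω0.le) x
  refine key.trans ((setIntegral_le_integral hΨ (Eventually.of_forall hΨ0)).trans ?_)
  rw [integral_const_mul, integral_add hfg hΩ, integral_indicator measurableSet_Icc,
    setIntegral_const, hNv, smul_eq_mul]
  have h1 : ∫ x, |f x - (|g x|)| ≤ η / 2 := by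
    refine (integral_mono hfg (hf.sub hgi).norm fun x => ?_).trans hgη
    have := abs_abs_sub_abs_le (f x) (g x)
    rwa [abs_of_nonneg (hf0 x)] at this
  have h2 : 2 * (|R| + 1) * ω = η / 2 := by rw [hω]; field_simp
  rw [h2]
  gcongr
  linarith

section gibbs
variable {μ : Measure ℝ} [IsProbabilityMeasure μ] {f : ℝ → ℝ} {I : ℝ → ℤ} {G φ : ℝ → ℝ}

lemma lintegral_index_mul_div_le_one (hfm : Measurable f) (hf0 : ∀ x, 0 ≤ f x)
    (hμf : μ = volume.withDensity fun x => ENNReal.ofReal (f x)) (hI : Measurable I)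
    (hG : Measurable G) (hG1 : ∀ i, ∫⁻ x in I ⁻¹' {i}, ENNReal.ofReal (G x) ≤ 1) :
    ∫⁻ x, ENNReal.ofReal ((μ (I ⁻¹' {I x})).toReal * G x / f x) ∂μ ≤ 1 := by
  have hp := measurable_comp_index hI fun i => (μ (I ⁻¹' {i})).toReal
  have hS : ∀ i, MeasurableSet (I ⁻¹' {i}) := fun i => hI (measurableSet_singleton i)
  have hdis : Pairwise (Function.onFun Disjoint fun i => I ⁻¹' {i}) := fun i j hij =>
    Disjoint.preimage _ (by simpa using hij)
  have hcov : ⋃ i, I ⁻¹' {i} = univ := by ext x; simp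
  calc ∫⁻ x, ENNReal.ofReal ((μ (I ⁻¹' {I x})).toReal * G x / f x) ∂μ
      = ∫⁻ x, ENNReal.ofReal (f x) * ENNReal.ofReal ((μ (I ⁻¹' {I x})).toReal * G x / f x) := by
        nth_rewrite 1 [hμf]
        rw [lintegral_withDensity_eq_lintegral_mul _ hfm.ennreal_ofReal (by fun_prop)]
        rfl
    _ ≤ ∫⁻ x, ENNReal.ofReal ((μ (I ⁻¹' {I x})).toReal * G x) := by
        refine lintegral_mono fun x => ?_
        rw [← ENNReal.ofReal_mul (hf0 x)]
        rcases (hf0 x).eq_or_lt with h | h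
        · simp [← h]
        · rw [mul_div_cancel₀ _ h.ne']
    _ = ∑' i, ∫⁻ x in I ⁻¹' {i}, ENNReal.ofReal ((μ (I ⁻¹' {I x})).toReal * G x) := by
        rw [← lintegral_iUnion hS hdis, hcov, Measure.restrict_univ]
    _ ≤ ∑' i, μ (I ⁻¹' {i}) := by
        refine ENNReal.tsum_le_tsum fun i => ?_
        have : ∫⁻ x in I ⁻¹' {i}, ENNReal.ofReal ((μ (I ⁻¹' {I x})).toReal * G x)
            = ∫⁻ x in I ⁻¹' {i}, μ (I ⁻¹' {i}) * ENNReal.ofReal (G x) := by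
          refine setLIntegral_congr_fun (hS i) fun x hx => ?_
          have hx' : I x = i := hx
          simp only [hx']
          rw [ENNReal.ofReal_mul ENNReal.toReal_nonneg, ENNReal.ofReal_toReal (measure_ne_top _ _)]
        rw [this, lintegral_const_mul _ hG.ennreal_ofReal]
        exact mul_le_of_le_one_right' (hG1 i)
    _ = 1 := by rw [← measure_iUnion hdis hS, hcov, measure_univ]

/-- Gibbs' inequality for a partition and subprobability densities on its cells. -/
lemma integral_le_tsum_negMulLog_add (hfm : Measurable f) (hf0 : ∀ x, 0 ≤ f x)
    (hμf : μ = volume.withDensity fun x => ENNReal.ofReal (f x))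
    (hlogf : Integrable (fun x => Real.log (f x)) μ) (hI : Measurable I)
    (hs : Summable fun i => Real.negMulLog (μ (I ⁻¹' {i})).toReal)
    (hG : Measurable G) (hG0 : ∀ x, 0 < G x)
    (hG1 : ∀ i, ∫⁻ x in I ⁻¹' {i}, ENNReal.ofReal (G x) ≤ 1) (hφ : Integrable φ μ)
    (hφG : ∀ᵐ x ∂μ, φ x ≤ Real.log (G x)) :
    ∫ x, φ x ∂μ ≤ ∑' i, Real.negMulLog (μ (I ⁻¹' {i})).toReal + ∫ x, Real.log (f x) ∂μ := by
  have hp := measurable_comp_index hI fun i => (μ (I ⁻¹' {i})).toReal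
  have hlin := lintegral_index_mul_div_le_one hfm hf0 hμf hI hG hG1
  set T : ℝ → ℝ := fun x => (μ (I ⁻¹' {I x})).toReal * G x / f x with hT
  have hTm : Measurable T := by fun_prop
  have hT0 : ∀ x, 0 ≤ T x := fun x =>
    div_nonneg (mul_nonneg ENNReal.toReal_nonneg (hG0 x).le) (hf0 x)
  have hTi : Integrable T μ := by
    refine ⟨hTm.aestronglyMeasurable, ?_⟩
    rw [hasFiniteIntegral_iff_ofReal (Eventually.of_forall hT0)]
    exact hlin.trans_lt ENNReal.one_lt_top
  have hT1 : ∫ x, T x ∂μ ≤ 1 := by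
    rw [integral_eq_lintegral_of_nonneg_ae (Eventually.of_forall hT0) hTm.aestronglyMeasurable]
    exact ENNReal.toReal_le_of_le_ofReal zero_le_one (by simpa using hlin)
  have hlp : Integrable (fun x => -Real.log (μ (I ⁻¹' {I x})).toReal) μ :=
    (integrable_log_index hI hs).neg
  have hT2 : Integrable (fun x => T x - 1) μ := hTi.sub (integrable_const 1)
  have hsum : Integrable (fun x => -Real.log (μ (I ⁻¹' {I x})).toReal + Real.log (f x)) μ :=
    hlp.add hlogf
  have hsum' : Integrable (fun x => -Real.log (μ (I ⁻¹' {I x})).toReal + Real.log (f x)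
    + (T x - 1)) μ := hsum.add hT2
  have hle : ∫ x, φ x ∂μ ≤ ∫ x, (-Real.log (μ (I ⁻¹' {I x})).toReal + Real.log (f x)
      + (T x - 1)) ∂μ := by
    refine integral_mono_ae hφ hsum' ?_
    filter_upwards [hφG, ae_pos_of_density hfm hμf, ae_index_pos (μ := μ) I] with x h1 h2 h3
    have h4 := Real.log_le_sub_one_of_pos (show 0 < T x from div_pos (mul_pos h3 (hG0 x)) h2)
    rw [hT, Real.log_div (mul_pos h3 (hG0 x)).ne' h2.ne', Real.log_mul h3.ne' (hG0 x).ne'] at h4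
    simp only at h4 ⊢
    linarith
  rw [integral_add hsum hT2, integral_sub hTi (integrable_const 1),
    integral_add hlp hlogf, integral_neg_log_index hI hs] at hle
  simp only [integral_const, probReal_univ, one_smul] at hle
  linarith

end gibbs

lemma exists_pos_le_sub_one_sub_log {θ : ℝ} (hθ : 0 < θ) :
    ∃ κ > 0, ∀ t, 0 < t → θ < |t - 1| → κ ≤ t - 1 - Real.log t := by
  refine ⟨min (θ ^ 2 / 9) 1, by positivity, fun t ht hθt => ?_⟩
  have hs := Real.sqrt_pos.2 ht
  have h1 := Real.log_le_sub_one_of_pos hs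
  have h2 : Real.log t = 2 * Real.log (√t) := by rw [Real.log_sqrt ht.le]; ring
  have h3 : t = √t ^ 2 := (Real.sq_sqrt ht.le).symm
  set u := √t
  have h4 : (u - 1) ^ 2 ≤ t - 1 - Real.log t := by nlinarith
  refine le_trans ?_ h4
  have h5 : |t - 1| = |u - 1| * (u + 1) := by
    rw [h3, ← abs_of_pos (show 0 < u + 1 by linarith), ← abs_mul]; ring_nf
  rcases le_or_gt u 2 with hu | hu
  · refine (min_le_left _ _).trans ?_
    have h6 : θ ≤ |u - 1| * 3 := by nlinarith [abs_nonneg (u - 1)]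
    rw [← sq_abs (u - 1)]
    nlinarith
  · exact (min_le_right _ _).trans (by nlinarith)

lemma lintegral_noiseDensity {r ε : ℝ} (hr : 0 < r) (hε : 0 < ε) (x : ℝ) :
    ∫⁻ y, ENNReal.ofReal (noiseDensity r ε x y) = 1 := by
  have hG := measurable_genGauss r
  have hγ := isProbabilityMeasure_genGaussLaw hr
  have h := lintegral_comp_add_mul x hε
    (h := fun y => ENNReal.ofReal (genGauss r ((y - x) / ε))) (by fun_prop)
  simp only [add_sub_cancel_left, mul_div_cancel_left₀ _ hε.ne'] at h
  have h1 : ∫⁻ z, ENNReal.ofReal (genGauss r z) = 1 := by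
    rw [← measure_univ (μ := genGaussLaw r), genGaussLaw, withDensity_apply _ MeasurableSet.univ,
      Measure.restrict_univ]
  rw [← h1, h]
  exact lintegral_congr fun y => ENNReal.ofReal_mul (genGauss_pos hr _).le

/-- A mixture of the uniform density on the truncated cell and a generalized Gaussian density
around the reconstruction point. -/
def cellMixture (I : ℝ → ℤ) (c : ℤ → ℝ) (r s ε δ x : ℝ) : ℝ :=
  (1 - δ) * ({x | |x - c (I x)| ≤ s}.indicator 1 x / truncCellLength I c s (I x))
    + δ * noiseDensity r ε (c (I x)) x

section mixture
variable {I : ℝ → ℤ} {c : ℤ → ℝ} {r s ε δ : ℝ}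

lemma measurable_cellMixture (hI : Measurable I) : Measurable (cellMixture I c r s ε δ) := by
  have h1 := measurable_comp_index hI c
  have h2 := measurable_comp_index hI (truncCellLength I c s)
  have h3 : Measurable ({x | |x - c (I x)| ≤ s}.indicator (1 : ℝ → ℝ)) :=
    measurable_one.indicator (measurableSet_abs_sub_le hI)
  have h4 := measurable_genGauss r
  unfold cellMixture noiseDensity
  fun_prop

lemma indicator_div_truncCellLength_nonneg (x : ℝ) :
    0 ≤ {x | |x - c (I x)| ≤ s}.indicator (1 : ℝ → ℝ) x / truncCellLength I c s (I x) :=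
  div_nonneg (indicator_nonneg (fun _ _ => zero_le_one) x) (truncCellLength_nonneg _)

lemma le_cellMixture (hδ1 : δ < 1) (x : ℝ) :
    δ * noiseDensity r ε (c (I x)) x ≤ cellMixture I c r s ε δ x :=
  le_add_of_nonneg_left (mul_nonneg (by linarith) (indicator_div_truncCellLength_nonneg x))

lemma cellMixture_pos (hr : 0 < r) (hε : 0 < ε) (hδ0 : 0 < δ) (hδ1 : δ < 1) (x : ℝ) :
    0 < cellMixture I c r s ε δ x :=
  (mul_pos hδ0 (noiseDensity_pos hr hε _ _)).trans_le (le_cellMixture hδ1 x)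

lemma lintegral_cellMixture_le_one (hr : 0 < r) (hε : 0 < ε) (hδ0 : 0 < δ) (hδ1 : δ < 1)
    (hI : Measurable I) (i : ℤ) :
    ∫⁻ x in I ⁻¹' {i}, ENNReal.ofReal (cellMixture I c r s ε δ x) ≤ 1 := by
  have hS : MeasurableSet (I ⁻¹' {i}) := hI (measurableSet_singleton i)
  have hB := measurableSet_truncCell (c := c) (s := s) hI i
  set B := {x | I x = i ∧ |x - c i| ≤ s} with hBdef
  set l := truncCellLength I c s i with hl
  have hl0 : 0 ≤ l := truncCellLength_nonneg i
  have hBfin : volume B ≠ ⊤ := by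
    refine ((measure_mono fun x hx => ?_).trans_lt
      (measure_Icc_lt_top (a := c i - s) (b := c i + s))).ne
    have := abs_le.1 hx.2
    constructor <;> linarith
  have hBl : volume B = ENNReal.ofReal l := (ENNReal.ofReal_toReal hBfin).symm
  have hm : Measurable fun x => ENNReal.ofReal (δ * noiseDensity r ε (c i) x) := by
    have h4 := measurable_genGauss r
    unfold noiseDensity
    fun_prop
  calc ∫⁻ x in I ⁻¹' {i}, ENNReal.ofReal (cellMixture I c r s ε δ x)
      = ∫⁻ x in I ⁻¹' {i}, (B.indicator (fun _ => ENNReal.ofReal ((1 - δ) / l)) x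
          + ENNReal.ofReal (δ * noiseDensity r ε (c i) x)) := by
        refine setLIntegral_congr_fun hS fun x hx => ?_
        have hx' : I x = i := hx
        have h0 := noiseDensity_pos hr hε (c i) x
        simp only [cellMixture, hx', ← hl]
        by_cases hxs : |x - c i| ≤ s
        · have h1 : x ∈ {x | |x - c (I x)| ≤ s} := by simpa [hx'] using hxs
          have h2 : x ∈ B := ⟨hx', hxs⟩
          rw [indicator_of_mem h1, indicator_of_mem h2, ← ENNReal.ofReal_add
            (div_nonneg (by linarith) hl0) (by positivity), Pi.one_apply, mul_one_div]
        · have h1 : x ∉ {x | |x - c (I x)| ≤ s} := by simpa [hx'] using hxs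
          have h2 : x ∉ B := fun h => hxs h.2
          rw [indicator_of_notMem h1, indicator_of_notMem h2]
          simp
    _ ≤ ∫⁻ x, (B.indicator (fun _ => ENNReal.ofReal ((1 - δ) / l)) x
          + ENNReal.ofReal (δ * noiseDensity r ε (c i) x)) := setLIntegral_le_lintegral _ _
    _ = ENNReal.ofReal ((1 - δ) / l) * ENNReal.ofReal l + ENNReal.ofReal δ := by
        rw [lintegral_add_right _ hm, lintegral_indicator_const hB, hBl]
        simp_rw [ENNReal.ofReal_mul hδ0.le]
        rw [lintegral_const_mul' _ _ ENNReal.ofReal_ne_top, lintegral_noiseDensity hr hε, mul_one]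
    _ ≤ ENNReal.ofReal (1 - δ) + ENNReal.ofReal δ := by
        gcongr
        rw [← ENNReal.ofReal_mul (div_nonneg (by linarith) hl0)]
        refine ENNReal.ofReal_le_ofReal ?_
        rcases hl0.eq_or_lt with h | h
        · rw [← h]; simp; linarith
        · rw [div_mul_cancel₀ _ h.ne']
    _ = 1 := by rw [← ENNReal.ofReal_add (by linarith) hδ0.le]; simp

end mixture

lemma ae_truncCellLength_pos {μ : Measure ℝ} (hμ : μ ≪ volume) (I : ℝ → ℤ) (c : ℤ → ℝ) (s : ℝ) :
    ∀ᵐ x ∂μ, |x - c (I x)| ≤ s → 0 < truncCellLength I c s (I x) := by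
  refine hμ.ae_le ?_
  have h : volume (⋃ i ∈ {i | volume {x | I x = i ∧ |x - c i| ≤ s} = 0},
      {x | I x = i ∧ |x - c i| ≤ s}) = 0 :=
    (measure_biUnion_null_iff (to_countable _)).2 fun i hi => hi
  filter_upwards [measure_eq_zero_iff_ae_notMem.1 h] with x hx hxs
  refine ENNReal.toReal_pos (fun h0 => hx ?_) ?_
  · exact mem_biUnion (x := I x) h0 ⟨rfl, hxs⟩
  · refine ((measure_mono fun y hy => ?_).trans_lt
      (measure_Icc_lt_top (a := c (I x) - s) (b := c (I x) + s))).ne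
    have := abs_le.1 hy.2
    constructor <;> linarith

/-- Log-likelihood bound for `cellMixture`, with a gain on the cells of atypical length. -/
lemma le_log_cellMixture {I : ℝ → ℤ} {c : ℤ → ℝ} {r s ε δ κ θ : ℝ} (hr : 0 < r) (hε : 0 < ε)
    (hδ0 : 0 < δ) (hδ1 : δ < 1) (hκ : ∀ t, 0 < t → θ < |t - 1| → κ ≤ t - 1 - Real.log t) {x : ℝ}
    (hpos : |x - c (I x)| ≤ s → 0 < truncCellLength I c s (I x)) :
    (Real.log (1 - δ) - Real.log ε - Real.log (cellLength r) + 1 / r)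
      + (Real.log δ - Real.log (genGaussConst r) - Real.log (1 - δ) + Real.log (cellLength r)
          - 1 / r) * {x | |x - c (I x)| ≤ s}ᶜ.indicator 1 x
      + κ / r * {x | |x - c (I x)| ≤ s ∧
          θ < |(truncCellLength I c s (I x) / cellLength r) ^ r / ε ^ r - 1|}.indicator 1 x
      - 1 / (r * ε ^ r) * ({x | |x - c (I x)| ≤ s}.indicator
          (fun x => (truncCellLength I c s (I x) / cellLength r) ^ r - |x - c (I x)| ^ r) x
        + |x - c (I x)| ^ r)
      ≤ Real.log (cellMixture I c r s ε δ x) := by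
  have hL := cellLength_pos hr
  have hεr : 0 < ε ^ r := by positivity
  have hφ0 := noiseDensity_pos hr hε (c (I x)) x
  by_cases hx : |x - c (I x)| ≤ s
  · have hl := hpos hx
    set l := truncCellLength I c s (I x) with hldef
    set t := (l / cellLength r) ^ r / ε ^ r with ht
    have ht0 : 0 < t := by positivity
    have hxB : x ∈ {x | |x - c (I x)| ≤ s} := hx
    have hlogt : Real.log t
        = r * (Real.log l - Real.log (cellLength r)) - r * Real.log ε := by
      rw [ht, Real.log_div (by positivity) hεr.ne', Real.log_rpow (by positivity),
        Real.log_rpow hε, Real.log_div hl.ne' hL.ne']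
    have hmix : (1 - δ) / l ≤ cellMixture I c r s ε δ x := by
      rw [cellMixture, indicator_of_mem hxB, Pi.one_apply, mul_one_div, ← hldef]
      have : 0 < δ * noiseDensity r ε (c (I x)) x := by positivity
      linarith
    have hlog := Real.log_le_log (div_pos (by linarith) hl) hmix
    rw [Real.log_div (by linarith) hl.ne'] at hlog
    refine le_trans ?_ hlog
    rw [indicator_of_mem hxB, indicator_of_notMem (by simpa using hx)]
    have hK : κ * {x | |x - c (I x)| ≤ s ∧
        θ < |(truncCellLength I c s (I x) / cellLength r) ^ r / ε ^ r - 1|}.indicator 1 x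
        ≤ t - 1 - Real.log t := by
      by_cases hb : θ < |t - 1|
      · have hxW : x ∈ {x | |x - c (I x)| ≤ s ∧
            θ < |(truncCellLength I c s (I x) / cellLength r) ^ r / ε ^ r - 1|} := ⟨hx, hb⟩
        rw [indicator_of_mem hxW, Pi.one_apply, mul_one]
        exact hκ t ht0 hb
      · rw [indicator_of_notMem fun h => hb h.2, mul_zero]
        linarith [Real.log_le_sub_one_of_pos ht0]
    set W := {x | |x - c (I x)| ≤ s ∧
        θ < |(truncCellLength I c s (I x) / cellLength r) ^ r / ε ^ r - 1|}.indicator (1 : ℝ → ℝ) x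
    have e1 : 1 / (r * ε ^ r) * ((l / cellLength r) ^ r - |x - c (I x)| ^ r + |x - c (I x)| ^ r)
        = t / r := by rw [ht]; field_simp; ring
    rw [e1]
    have e2 : Real.log l = Real.log t / r + Real.log (cellLength r) + Real.log ε := by
      rw [hlogt]; field_simp; ring
    rw [e2]
    have hK' := div_le_div_of_nonneg_right hK hr.le
    have e3 : (t - 1 - Real.log t) / r = t / r - 1 / r - Real.log t / r := by ring
    have e4 : κ * W / r = κ / r * W := by ring
    rw [e3, e4] at hK'
    linarith
  · have hmix := Real.log_le_log (by positivity)
      (le_cellMixture (I := I) (c := c) (r := r) (s := s) (ε := ε) hδ1 x)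
    refine le_trans ?_ hmix
    rw [indicator_of_mem (show x ∈ {x | |x - c (I x)| ≤ s}ᶜ from hx),
      indicator_of_notMem (fun h => hx h.1), 
      indicator_of_notMem (show x ∉ {x | |x - c (I x)| ≤ s} from hx), Real.log_mul hδ0.ne' hφ0.ne',
      noiseDensity, Real.log_mul (genGauss_pos hr _).ne' (inv_pos.2 hε).ne', Real.log_inv,
      log_genGauss hr, abs_div, abs_of_pos hε, Real.div_rpow (abs_nonneg _) hε.le, Pi.one_apply]
    have : 1 / (r * ε ^ r) * (0 + |x - c (I x)| ^ r) = |x - c (I x)| ^ r / ε ^ r / r := by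
      field_simp; ring
    rw [this]
    linarith

section
variable {μ : Measure ℝ} [IsProbabilityMeasure μ] {f : ℝ → ℝ} {I : ℝ → ℤ} {c : ℤ → ℝ}
  {r ε ρ δ κ θ η : ℝ}

lemma measure_compl_truncation_le (hr : 0 < r) (hε : 0 < ε) (hρ : 0 < ρ)
    (hdi : Integrable (fun x => |x - c (I x)| ^ r) μ)
    (hd : ∫ x, |x - c (I x)| ^ r ∂μ ≤ ε ^ r) :
    μ.real {x | |x - c (I x)| ≤ ρ * ε}ᶜ ≤ (ρ ^ r)⁻¹ := by
  have h1 := mul_meas_ge_le_integral_of_nonneg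
    (Eventually.of_forall fun x => by positivity) hdi ((ρ * ε) ^ r)
  have h2 : μ.real {x | |x - c (I x)| ≤ ρ * ε}ᶜ
      ≤ μ.real {x | (ρ * ε) ^ r ≤ |x - c (I x)| ^ r} := by
    refine measureReal_mono fun x hx => ?_
    exact Real.rpow_le_rpow (by positivity)
      (not_le.1 (show ¬ |x - c (I x)| ≤ ρ * ε from hx)).le hr.le
  have h3 : 0 < ε ^ r := by positivity
  have h4 : 0 < ρ ^ r := by positivity
  have h5 : ρ ^ r * ε ^ r * μ.real {x | |x - c (I x)| ≤ ρ * ε}ᶜ ≤ ε ^ r := by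
    rw [← Real.mul_rpow hρ.le hε.le]
    exact (mul_le_mul_of_nonneg_left h2 (by positivity)).trans (h1.trans hd)
  rw [← one_div, le_div_iff₀ h4]
  refine le_of_mul_le_mul_right ?_ h3
  linarith

lemma measure_atypical_le (hr : 0 < r) (hfm : Measurable f) (hf0 : ∀ x, 0 ≤ f x)
    (hμf : μ = volume.withDensity fun x => ENNReal.ofReal (f x))
    (hlogf : Integrable (fun x => Real.log (f x)) μ) (hI : Measurable I)
    (hs : Summable fun i => Real.negMulLog (μ (I ⁻¹' {i})).toReal)
    (hε : 0 < ε) (hρ : 0 < ρ) (hδ0 : 0 < δ) (hδ1 : δ < 1)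
    (hκ : ∀ t, 0 < t → θ < |t - 1| → κ ≤ t - 1 - Real.log t)
    (hdi : Integrable (fun x => |x - c (I x)| ^ r) μ)
    (hd : ∫ x, |x - c (I x)| ^ r ∂μ ≤ ε ^ r)
    (hη : ∫ x in {x | |x - c (I x)| ≤ ρ * ε},
        ((truncCellLength I c (ρ * ε) (I x) / cellLength r) ^ r - |x - c (I x)| ^ r) * f x
          ≤ (ρ * ε) ^ r * η) :
    κ / r * μ.real {x | |x - c (I x)| ≤ ρ * ε ∧
        θ < |(truncCellLength I c (ρ * ε) (I x) / cellLength r) ^ r / ε ^ r - 1|}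
      ≤ ∑' i, Real.negMulLog (μ (I ⁻¹' {i})).toReal + ∫ x, Real.log (f x) ∂μ + Real.log ε
        + Real.log (cellLength r) - Real.log (1 - δ) + ρ ^ r * η / r
        + |Real.log δ - Real.log (genGaussConst r) - Real.log (1 - δ) + Real.log (cellLength r)
          - 1 / r| * (ρ ^ r)⁻¹ := by
  have hs0 : 0 < ρ * ε := by positivity
  have hεr : 0 < ε ^ r := by positivity
  have hB := measurableSet_abs_sub_le (c := c) (s := ρ * ε) hI
  have hci := measurable_comp_index hI c
  have hti := measurable_comp_index hI fun i =>
    (truncCellLength I c (ρ * ε) i / cellLength r) ^ r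
  set W := {x | |x - c (I x)| ≤ ρ * ε ∧
    θ < |(truncCellLength I c (ρ * ε) (I x) / cellLength r) ^ r / ε ^ r - 1|} with hW
  have hWm : MeasurableSet W := hB.inter (measurableSet_lt measurable_const (g := fun x =>
    |(truncCellLength I c (ρ * ε) (I x) / cellLength r) ^ r / ε ^ r - 1|) (by fun_prop))
  set A := Real.log δ - Real.log (genGaussConst r) - Real.log (1 - δ) + Real.log (cellLength r)
    - 1 / r with hA
  set C := Real.log (1 - δ) - Real.log ε - Real.log (cellLength r) + 1 / r with hC
  set B := {x | |x - c (I x)| ≤ ρ * ε} with hBdef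
  set k := fun x => (truncCellLength I c (ρ * ε) (I x) / cellLength r) ^ r - |x - c (I x)| ^ r
    with hk
  have hkm : Measurable k := by fun_prop
  have hki : Integrable (B.indicator k) μ := by
    refine Integrable.of_bound (C := (ρ * ε) ^ r) (hkm.indicator hB).aestronglyMeasurable
      (Eventually.of_forall fun x => ?_)
    by_cases hx : x ∈ B
    · rw [indicator_of_mem hx]
      exact abs_truncCellLength_rpow_sub_le hr hs0.le hx
    · rw [indicator_of_notMem hx, norm_zero]; positivity
  have hk1 : ∫ x, B.indicator k x ∂μ ≤ (ρ * ε) ^ r * η := by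
    rw [integral_eq_of_density hfm hf0 hμf]
    refine (Eq.le ?_).trans hη
    rw [← integral_indicator hB]
    congr 1; ext x
    by_cases hx : x ∈ B
    · rw [indicator_of_mem hx, indicator_of_mem hx, mul_comm]
    · rw [indicator_of_notMem hx, indicator_of_notMem hx, mul_zero]
  have iB : Integrable (fun x => A * Bᶜ.indicator 1 x) μ :=
    ((integrable_const (1 : ℝ)).indicator hB.compl).const_mul A
  have iC : Integrable (fun x => C + A * Bᶜ.indicator 1 x) μ := (integrable_const C).add iB
  have iW : Integrable (fun x => κ / r * W.indicator 1 x) μ :=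
    ((integrable_const (1 : ℝ)).indicator hWm).const_mul _
  have i1 : Integrable (fun x => C + A * Bᶜ.indicator 1 x + κ / r * W.indicator 1 x) μ :=
    iC.add iW
  have i2 : Integrable (fun x => 1 / (r * ε ^ r) * (B.indicator k x + |x - c (I x)| ^ r)) μ :=
    (hki.add hdi).const_mul _
  have hgibbs := integral_le_tsum_negMulLog_add hfm hf0 hμf hlogf hI hs
    (measurable_cellMixture (c := c) (r := r) (s := ρ * ε) (ε := ε) (δ := δ) hI)
    (cellMixture_pos hr hε hδ0 hδ1) (lintegral_cellMixture_le_one hr hε hδ0 hδ1 hI)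
    (i1.sub i2) (by
      filter_upwards [ae_truncCellLength_pos
        (hμf ▸ withDensity_absolutelyContinuous _ _ : μ ≪ volume) I c (ρ * ε)] with x hx
      exact le_log_cellMixture hr hε hδ0 hδ1 hκ hx)
  have e1 : ∫ x, (C + A * Bᶜ.indicator 1 x + κ / r * W.indicator 1 x) ∂μ
      = C + A * μ.real Bᶜ + κ / r * μ.real W := by
    rw [integral_add iC iW, integral_add (integrable_const C) iB, integral_const_mul,
      integral_const_mul, integral_indicator_one hB.compl, integral_indicator_one hWm]
    simp
  rw [integral_sub' i1 i2, e1, integral_const_mul, integral_add hki hdi] at hgibbs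
  have h1 : -(|A| * (ρ ^ r)⁻¹) ≤ A * μ.real Bᶜ := by
    have h2 := measure_compl_truncation_le (μ := μ) hr hε hρ hdi hd
    have h3 : 0 ≤ μ.real Bᶜ := measureReal_nonneg
    nlinarith [neg_abs_le A, abs_nonneg A]
  have h2 : 1 / (r * ε ^ r) * (∫ x, B.indicator k x ∂μ + ∫ x, |x - c (I x)| ^ r ∂μ)
      ≤ ρ ^ r * η / r + 1 / r := by
    have h3 : 1 / (r * ε ^ r) * ((ρ * ε) ^ r * η + ε ^ r) = ρ ^ r * η / r + 1 / r := by
      rw [Real.mul_rpow hρ.le hε.le]; field_simp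
    rw [← h3]
    gcongr
  linarith

end

section liminf
variable {α : Type*} {l : Filter α} {G : α → ℝ}

lemma eventually_pos_of_liminf_pos (h : 0 < liminf G l) : ∀ᶠ x in l, 0 < G x := by
  rw [liminf_eq] at h
  by_contra hG
  refine h.not_ge (Real.sSup_nonpos fun a ha => ?_)
  by_contra! ha0
  exact hG (ha.mono fun x hx => ha0.trans_le hx)

lemma frequently_lt_of_liminf_pos (h : 0 < liminf G l) {η : ℝ} (hη : 0 < η) :
    ∃ᶠ x in l, G x < liminf G l + η := by
  intro hG
  have hmem : liminf G l + η ∈ {a | ∀ᶠ x in l, a ≤ G x} := hG.mono fun x hx => not_lt.1 hx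
  by_cases hb : BddAbove {a | ∀ᶠ x in l, a ≤ G x}
  · have := le_csSup hb hmem
    rw [← liminf_eq] at this
    linarith
  · rw [liminf_eq, Real.sSup_of_not_bddAbove hb] at h
    exact h.false

end liminf

section quantizer

lemma Quantizer.exists_index {E : Type*} [MeasurableSpace E] (Q : Quantizer E) :
    ∃ I : E → ℤ, Measurable I ∧ ∀ i, I ⁻¹' {i} = Q.S i := by
  choose I hI using fun x => mem_iUnion.1 (Q.cover ▸ mem_univ x : x ∈ ⋃ i, Q.S i)
  have h : ∀ i, I ⁻¹' {i} = Q.S i := by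
    intro i
    ext x
    refine ⟨fun hx => ?_, fun hx => ?_⟩
    · obtain rfl : I x = i := hx
      exact hI x
    · by_contra hne
      exact disjoint_left.1 (Q.disj hne) (hI x) hx
  exact ⟨I, measurable_to_countable' fun i => h i ▸ Q.meas i, h⟩

variable {μ : Measure ℝ} {Q : Quantizer ℝ} {I : ℝ → ℤ} {r : ℝ}

lemma Quantizer.distortion_eq_lintegral (hI : ∀ i, I ⁻¹' {i} = Q.S i) :
    Q.distortion μ (fun x => |x|) r = ∫⁻ x, ENNReal.ofReal (|x - Q.c (I x)| ^ r) ∂μ := by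
  rw [← setLIntegral_univ, ← Q.cover, lintegral_iUnion Q.meas Q.disj, Quantizer.distortion]
  refine tsum_congr fun i => setLIntegral_congr_fun (Q.meas i) fun x hx => ?_
  rw [← hI i] at hx
  rw [show I x = i from hx]

lemma Quantizer.integrable_and_integral_le (hIm : Measurable I) (hI : ∀ i, I ⁻¹' {i} = Q.S i)
    {D : ℝ} (hD : 0 ≤ D) (h : Q.distortion μ (fun x => |x|) r ≤ ENNReal.ofReal D) :
    Integrable (fun x => |x - Q.c (I x)| ^ r) μ ∧ ∫ x, |x - Q.c (I x)| ^ r ∂μ ≤ D := by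
  rw [Quantizer.distortion_eq_lintegral hI] at h
  have hci := measurable_comp_index hIm Q.c
  have hm : Measurable fun x => |x - Q.c (I x)| ^ r := by fun_prop
  have h0 : ∀ x, 0 ≤ |x - Q.c (I x)| ^ r := fun x => by positivity
  refine ⟨⟨hm.aestronglyMeasurable, ?_⟩, ?_⟩
  · rw [hasFiniteIntegral_iff_ofReal (Eventually.of_forall h0)]
    exact h.trans_lt ENNReal.ofReal_lt_top
  · rw [integral_eq_lintegral_of_nonneg_ae (Eventually.of_forall h0) hm.aestronglyMeasurable]
    exact ENNReal.toReal_le_of_le_ofReal hD h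

variable [IsProbabilityMeasure μ]

lemma Quantizer.tsum_measure_mul_ite (hIm : Measurable I) (hI : ∀ i, I ⁻¹' {i} = Q.S i)
    (p : ℤ → Prop) [DecidablePred p] :
    ∑' i, (μ (Q.S i)).toReal * (if p i then 1 else 0) = μ.real {x | p (I x)} := by
  have hm : Measurable fun x => if p (I x) then (1 : ℝ) else 0 :=
    measurable_comp_index hIm fun i => if p i then (1 : ℝ) else 0
  have hi : Integrable (fun x => if p (I x) then (1 : ℝ) else 0) μ := by
    refine Integrable.of_bound (C := 1) hm.aestronglyMeasurable (Eventually.of_forall fun x => ?_)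
    split_ifs <;> simp
  have hms : MeasurableSet {x | p (I x)} := hIm (MeasurableSet.of_discrete (s := {i | p i}))
  simp_rw [← hI]
  rw [← integral_comp_index hIm (a := fun i => if p i then (1 : ℝ) else 0) hi,
    ← integral_indicator_one hms]
  simp only [indicator_apply, mem_ofPred_eq, Pi.one_apply]

end quantizer

/-- A quantizer whose output entropy is close to the Shannon lower bound plus the optimal excess
rate has, up to a small probability, truncated cells of length close to `cellLength r * ε`. -/
lemma one_sub_le_tsum_typical {r : ℝ} (hr : 0 < r) {μ : Measure ℝ} [IsProbabilityMeasure μ]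
    {f : ℝ → ℝ} (hfm : Measurable f) (hf0 : ∀ x, 0 ≤ f x)
    (hμf : μ = volume.withDensity fun x => ENNReal.ofReal (f x))
    (hlogf : Integrable (fun x => Real.log (f x)) μ) (Q : Quantizer ℝ)
    (hs : Summable fun i => Real.negMulLog (μ (Q.S i)).toReal) {ε ρ δ κ ϑ η : ℝ}
    (hε : 0 < ε) (hρ : 0 < ρ) (hδ0 : 0 < δ) (hδ1 : δ < 1) (hκ0 : 0 < κ)
    (hκ : ∀ t, 0 < t → ϑ / cellLength r ^ r < |t - 1| → κ ≤ t - 1 - Real.log t)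
    (hd : Q.distortion μ (fun x => |x|) r ≤ ENNReal.ofReal (ε ^ r))
    (hη : ∀ I : ℝ → ℤ, Measurable I → ∫ x in {x | |x - Q.c (I x)| ≤ ρ * ε},
        ((truncCellLength I Q.c (ρ * ε) (I x) / cellLength r) ^ r - |x - Q.c (I x)| ^ r) * f x
          ≤ (ρ * ε) ^ r * η) :
    1 - (ρ ^ r)⁻¹ - r / κ * (Q.entropyR μ + ∫ x, Real.log (f x) ∂μ + Real.log ε
        + Real.log (cellLength r) - Real.log (1 - δ) + ρ ^ r * η / r
        + |Real.log δ - Real.log (genGaussConst r) - Real.log (1 - δ) + Real.log (cellLength r)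
          - 1 / r| * (ρ ^ r)⁻¹)
      ≤ ∑' i, (μ (Q.S i)).toReal *
          (if |(volume (Bcell Q (fun x => |x|) (ρ * ε) i)).toReal ^ r / ε ^ r
            - 2 ^ r * (1 + r)| ≤ ϑ then 1 else 0) := by
  obtain ⟨I, hIm, hI⟩ := Q.exists_index
  obtain ⟨hdi, hd'⟩ := Q.integrable_and_integral_le hIm hI (by positivity) hd
  have hcell : ∀ i, (volume (Bcell Q (fun x => |x|) (ρ * ε) i)).toReal
      = truncCellLength I Q.c (ρ * ε) i := by
    intro i
    simp only [truncCellLength, Bcell, ← hI i]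
    rfl
  have hL := cellLength_pos hr
  have hLr : 0 < cellLength r ^ r := by positivity
  rw [Q.tsum_measure_mul_ite hIm hI]
  have hs' : Summable fun i => Real.negMulLog (μ (I ⁻¹' {i})).toReal := by simpa only [hI]
  have hA := measure_atypical_le hr hfm hf0 hμf hlogf hIm hs' hε hρ hδ0 hδ1 hκ hdi hd' (hη I hIm)
  have hB := measure_compl_truncation_le hr hε hρ hdi hd'
  set T := {x | |x - Q.c (I x)| ≤ ρ * ε}ᶜ
  set W := {x | |x - Q.c (I x)| ≤ ρ * ε ∧ ϑ / cellLength r ^ r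
    < |(truncCellLength I Q.c (ρ * ε) (I x) / cellLength r) ^ r / ε ^ r - 1|} with hW
  set Z := {x | |(volume (Bcell Q (fun x => |x|) (ρ * ε) (I x))).toReal ^ r / ε ^ r
    - 2 ^ r * (1 + r)| ≤ ϑ} with hZ
  have hcov : univ ⊆ Z ∪ (T ∪ W) := by
    intro x _
    by_cases hx : x ∈ T
    · exact Or.inr (Or.inl hx)
    by_cases hg : x ∈ Z
    · exact Or.inl hg
    refine Or.inr (Or.inr ⟨not_not.1 hx, ?_⟩)
    have hg' := not_le.1 (show ¬ |_| ≤ ϑ from hg)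
    rw [hcell, ← cellLength_rpow hr] at hg'
    rw [div_lt_iff₀ hLr, ← abs_of_pos hLr, ← abs_mul,
      Real.div_rpow (truncCellLength_nonneg ..) hL.le]
    refine hg'.trans_eq ?_
    congr 1
    field_simp
  have h1 : 1 ≤ μ.real Z + (μ.real T + μ.real W) := by
    rw [← probReal_univ (μ := μ)]
    exact (measureReal_mono hcov).trans ((measureReal_union_le _ _).trans
      (by gcongr; exact measureReal_union_le _ _))
  have hent : Q.entropyR μ = ∑' i, Real.negMulLog (μ (I ⁻¹' {i})).toReal := by
    simp only [Quantizer.entropyR, hI]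
  rw [hent]
  have h2 := mul_le_mul_of_nonneg_left hA (show 0 ≤ r / κ by positivity)
  rw [← mul_assoc, show r / κ * (κ / r) = 1 by field_simp, one_mul] at h2
  linarith

/-- For any large enough truncation radius, the typical cells carry almost all the mass at
arbitrarily small distortions. -/
lemma frequently_one_sub_le_tsum_typical {r : ℝ} (hr : 0 < r)
    (μ : Measure ℝ) [IsProbabilityMeasure μ]
    (f : ℝ → ℝ) (hfm : Measurable f) (hf0 : ∀ x, 0 ≤ f x)
    (hμf : μ = volume.withDensity fun x => ENNReal.ofReal (f x))
    (hent : Integrable (fun x => f x * Real.log (f x)))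
    (hfloor : Summable fun k : ℤ => Real.negMulLog (μ {x | ⌊x⌋ = k}).toReal)
    (q : ℝ → Quantizer ℝ)
    (hdist : ∀ D, 0 < D → (q D).distortion μ (fun x => |x|) r ≤ ENNReal.ofReal D)
    (hach : Filter.liminf
        (fun D => (q D).entropyR μ - (RDfun μ (fun x => |x|) r D).toReal) (𝓝[>] (0:ℝ))
      = (1 / r) * Real.log (Real.Gamma (1 + 1 / r) ^ r * Real.exp 1 / (1 + 1 / r)))
    {ϑ : ℝ} (hϑ : 0 < ϑ) {τ : ℝ} (hτ : 0 < τ) :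
    ∀ᶠ ρ : ℝ in atTop, ∃ᶠ D in 𝓝[>] (0:ℝ), 1 - τ ≤
      ∑' i : ℤ, (μ ((q D).S i)).toReal *
        (if |(volume (Bcell (q D) (fun x => |x|) (ρ * D ^ (1 / r)) i)).toReal ^ r / D
              - 2 ^ r * (1 + r)| ≤ ϑ then 1 else 0) := by
  have hL := cellLength_pos hr
  have hlogf : Integrable (fun x => Real.log (f x)) μ :=
    (integrable_iff_of_density hfm hf0 hμf _).2 hent
  obtain ⟨κ, hκ0, hκ⟩ := exists_pos_le_sub_one_sub_log
    (show 0 < ϑ / cellLength r ^ r by positivity)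
  set η := τ * κ / (8 * r) with hη
  have hη0 : 0 < η := by positivity
  set δ := 1 - Real.exp (-η) with hδ
  have hδ0 : 0 < δ := by
    have := Real.exp_lt_one_iff.2 (neg_lt_zero.2 hη0)
    linarith
  have hδ1 : δ < 1 := by linarith [Real.exp_pos (-η)]
  have hlogδ : Real.log (1 - δ) = -η := by rw [hδ, sub_sub_cancel, Real.log_exp]
  set A := |Real.log δ - Real.log (genGaussConst r) - Real.log (1 - δ)
    + Real.log (cellLength r) - 1 / r| with hA
  have hlim : Tendsto (fun ρ : ℝ => (ρ ^ r)⁻¹ * (1 + r / κ * A)) atTop (𝓝 0) := by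
    simpa using (tendsto_rpow_atTop hr).inv_tendsto_atTop.mul_const (1 + r / κ * A)
  filter_upwards [hlim.eventually_le_const (show 0 < τ / 2 by positivity), eventually_gt_atTop 0]
    with ρ hρA hρ
  have hρr : 0 < ρ ^ r := by positivity
  obtain ⟨s₀, hs₀, hs⟩ := exists_forall_setIntegral_truncCellLength_le hr
    (integrable_of_density hfm hf0 hμf) hf0 (show 0 < r * η / ρ ^ r by positivity)
  have hroot : Tendsto (fun D : ℝ => D ^ (1 / r)) (𝓝[>] 0) (𝓝[>] 0) := by
    refine tendsto_nhdsWithin_iff.2 ⟨?_, ?_⟩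
    · have := (Real.continuousAt_rpow_const 0 (1 / r) (Or.inr (by positivity))).tendsto
      rw [Real.zero_rpow (by positivity)] at this
      exact this.mono_left nhdsWithin_le_nhds
    · filter_upwards [self_mem_nhdsWithin] with D hD
      exact Real.rpow_pos_of_pos hD _
  have hRD := hroot.eventually (eventually_RDfun_toReal_le hr hfm hf0 hμf hlogf hfloor hη0)
  have hsmall := hroot.eventually
    (mem_nhdsWithin_of_mem_nhds (Iio_mem_nhds (show 0 < s₀ / ρ by positivity)))
  have hC : 0 < liminf (fun D => (q D).entropyR μ - (RDfun μ (fun x => |x|) r D).toReal)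
      (𝓝[>] (0:ℝ)) := by
    rw [hach]; exact excess_pos hr
  have hfreq := frequently_lt_of_liminf_pos hC hη0
  rw [hach, excess_eq hr] at hfreq
  refine (hfreq.and_eventually (hRD.and (hsmall.and
    ((eventually_pos_of_liminf_pos hC).and self_mem_nhdsWithin)))).mono ?_
  rintro D ⟨hG, hR, hsD, hGpos, hD⟩
  have hD : 0 < D := hD
  have hDr : (D ^ (1 / r)) ^ r = D := by
    rw [← Real.rpow_mul hD.le, one_div_mul_cancel hr.ne', Real.rpow_one]
  set ε := D ^ (1 / r) with hεD
  have hε : 0 < ε := by positivity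
  have hsum : Summable fun i => Real.negMulLog (μ ((q D).S i)).toReal := by
    by_contra hns
    rw [Quantizer.entropyR, tsum_eq_zero_of_not_summable hns] at hGpos
    linarith [ENNReal.toReal_nonneg (a := RDfun μ (fun x => |x|) r D)]
  have hsε : ρ * ε ≤ s₀ := by
    have := (lt_div_iff₀ hρ).1 (show ε < s₀ / ρ from hsD)
    linarith
  have hmain := one_sub_le_tsum_typical hr hfm hf0 hμf hlogf (q D) hsum hε hρ hδ0 hδ1 hκ0 hκ
    (by rw [hDr]; exact hdist D hD) fun I hI => hs _ (by positivity) hsε I _ hI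
  rw [hDr] at hmain hR
  refine le_trans ?_ hmain
  rw [← hA, hlogδ, show ρ ^ r * (r * η / ρ ^ r) / r = η by field_simp]
  have hH : (q D).entropyR μ + ∫ x, Real.log (f x) ∂μ + Real.log ε
      + Real.log (cellLength r) - -η + η + A * (ρ ^ r)⁻¹ ≤ 4 * η + A * (ρ ^ r)⁻¹ := by
    linarith
  have h1 := mul_le_mul_of_nonneg_left hH (show 0 ≤ r / κ by positivity)
  have h2 : r / κ * (4 * η + A * (ρ ^ r)⁻¹) = τ / 2 + (ρ ^ r)⁻¹ * (r / κ * A) := by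
    rw [hη]; field_simp; ring
  linarith

/-- Theorem 3, necessary condition for asymptotic optimality:
if a family of scalar quantizers achieves the asymptotic excess rate, then the Lebesgue
measures `Λ_{i,ρ D^{1/r}}` of the truncated cells concentrate (in probability) at
`(2^r (1+r) D)^{1/r}` as `D ↓ 0` and `ρ → ∞`. -/
theorem necessary_condition_optimal_quantizers {r : ℝ} (hr : 0 < r)
    (μ : Measure ℝ) [IsProbabilityMeasure μ]
    (f : ℝ → ℝ) (hfm : Measurable f) (hf0 : ∀ x, 0 ≤ f x)
    (hμf : μ = volume.withDensity fun x => ENNReal.ofReal (f x))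
    (hent : Integrable (fun x => f x * Real.log (f x)))
    (hfloor : Summable fun k : ℤ => Real.negMulLog (μ {x | ⌊x⌋ = k}).toReal)
    (q : ℝ → Quantizer ℝ)
    (hdist : ∀ D, 0 < D → (q D).distortion μ (fun x => |x|) r ≤ ENNReal.ofReal D)
    (hach : Filter.liminf
        (fun D => (q D).entropyR μ - (RDfun μ (fun x => |x|) r D).toReal) (𝓝[>] (0:ℝ))
      = (1 / r) * Real.log (Real.Gamma (1 + 1 / r) ^ r * Real.exp 1 / (1 + 1 / r)))
    (ϑ : ℝ) (hϑ : 0 < ϑ) :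
    Tendsto (fun ρ : ℝ =>
        Filter.limsup (fun D => ∑' i : ℤ, (μ ((q D).S i)).toReal *
            (if |(volume (Bcell (q D) (fun x => |x|) (ρ * D ^ (1 / r)) i)).toReal ^ r / D
                  - 2 ^ r * (1 + r)| ≤ ϑ then 1 else 0))
          (𝓝[>] (0:ℝ)))
      atTop (𝓝 1) := by
  set F : ℝ → ℝ → ℝ := fun ρ D => ∑' i : ℤ, (μ ((q D).S i)).toReal *
    (if |(volume (Bcell (q D) (fun x => |x|) (ρ * D ^ (1 / r)) i)).toReal ^ r / D
      - 2 ^ r * (1 + r)| ≤ ϑ then 1 else 0) with hF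
  have hF01 : ∀ ρ D, F ρ D ∈ Icc (0 : ℝ) 1 := by
    intro ρ D
    obtain ⟨I, hIm, hI⟩ := (q D).exists_index
    simp only [hF]
    rw [(q D).tsum_measure_mul_ite hIm hI]
    exact ⟨measureReal_nonneg, measureReal_le_one⟩
  have hbdd : ∀ ρ, IsBoundedUnder (· ≤ ·) (𝓝[>] (0:ℝ)) (F ρ) := fun ρ =>
    isBoundedUnder_of ⟨1, fun D => (hF01 ρ D).2⟩
  have hcobdd : ∀ ρ, IsCoboundedUnder (· ≤ ·) (𝓝[>] (0:ℝ)) (F ρ) := fun ρ =>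
    (isBoundedUnder_of ⟨0, fun D => (hF01 ρ D).1⟩ :
      IsBoundedUnder (· ≥ ·) (𝓝[>] (0:ℝ)) (F ρ)).isCoboundedUnder_le
  refine tendsto_order.2 ⟨fun a ha => ?_, fun a ha => Eventually.of_forall fun ρ => ?_⟩
  · filter_upwards [frequently_one_sub_le_tsum_typical hr μ f hfm hf0 hμf hent hfloor q hdist hach
      hϑ (show 0 < (1 - a) / 2 by linarith)] with ρ hρ
    have := le_limsup_of_frequently_le hρ (hbdd ρ)
    exact lt_of_lt_of_le (by linarith) this
  · exact (limsup_le_of_le (hcobdd ρ) (Eventually.of_forall fun D => (hF01 ρ D).2)).trans_lt ha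

end
end

section
/- Let X be a random vector in ℝ^d and ‖·‖ a norm on ℝ^d. If E[ log(1 + ‖X‖) ] < ∞, then the componentwise integer part ⌊X⌋ has finite Shannon entropy: H(⌊X⌋) < ∞. In particular, H(⌊X⌋) < ∞ whenever E[‖X‖^α] < ∞ for some α > 0. -/
open MeasureTheory Filter Set
open scoped ENNReal Topology ProbabilityTheory Pointwise

noncomputable section

theorem exists_norm_le_mul_of_core {E F : Type*} [AddCommGroup E] [Module ℝ E]
    [FiniteDimensional ℝ E] [NormedAddCommGroup F] [NormedSpace ℝ F] [Norm E]
    (core : NormedSpace.Core ℝ E) (f : E →ₗ[ℝ] F) :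
    ∃ C, 0 ≤ C ∧ ∀ x, ‖f x‖ ≤ C * ‖x‖ := by
  let : NormedAddCommGroup E := NormedAddCommGroup.ofCore core
  let : NormedSpace ℝ E := NormedSpace.ofCore core
  exact ⟨‖f.toContinuousLinearMap‖, norm_nonneg _, f.toContinuousLinearMap.le_opNorm⟩

theorem IsNorm.exists_norm_le_mul {d : ℕ} {N : (Fin d → ℝ) → ℝ} (hN : IsNorm N) :
    ∃ C, 0 ≤ C ∧ ∀ x, ‖x‖ ≤ C * N x :=
  @exists_norm_le_mul_of_core (Fin d → ℝ) (Fin d → ℝ) _ _ _ _ _ ⟨N⟩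
    (let : Norm (Fin d → ℝ) := ⟨N⟩
     { norm_nonneg := hN.nonneg
       norm_smul := hN.smul
       norm_triangle := hN.triangle
       norm_eq_zero_iff := hN.eq_zero_iff }) LinearMap.id

theorem summable_prod_apply {ι α : Type*} [Fintype ι] {f : α → ℝ} (hf : ∀ a, 0 ≤ f a)
    (hs : Summable f) : Summable fun k : ι → α => ∏ j, f (k j) := by
  classical
  refine summable_of_sum_le (c := ∏ _j : ι, ∑' a, f a)
    (fun k => Finset.prod_nonneg fun j _ => hf _) fun s => ?_
  calc ∑ k ∈ s, ∏ j, f (k j)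
      ≤ ∑ k ∈ Fintype.piFinset fun j => s.image fun k => k j, ∏ j, f (k j) :=
        Finset.sum_le_sum_of_subset_of_nonneg
          (fun k hk => Fintype.mem_piFinset.2 fun j => Finset.mem_image_of_mem _ hk)
          fun k _ _ => Finset.prod_nonneg fun j _ => hf _
    _ = ∏ j : ι, ∑ a ∈ s.image fun k => k j, f a := (Finset.prod_univ_sum _ _).symm
    _ ≤ ∏ _j : ι, ∑' a, f a :=
        Finset.prod_le_prod (fun j _ => Finset.sum_nonneg fun a _ => hf a)
          fun j _ => hs.sum_le_tsum _ fun a _ => hf a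

theorem summable_int_inv_one_add_abs_sq :
    Summable fun n : ℤ => ((1 + |(n : ℝ)|) ^ 2)⁻¹ := by
  have h : Summable fun n : ℕ => ((1 + (n : ℝ)) ^ 2)⁻¹ := by
    have := (summable_nat_add_iff 1).2 (Real.summable_nat_pow_inv.2 one_lt_two)
    simpa [add_comm] using this
  exact Summable.of_nat_of_neg (by simpa using h) (by simpa using h)

theorem negMulLog_le_mul_neg_log_add {p q : ℝ} (hp : 0 ≤ p) (hq : 0 < q) :
    Real.negMulLog p ≤ p * (-Real.log q) + q := by
  rcases hp.eq_or_lt with rfl | hp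
  · simpa using hq.le
  · have h := Real.log_le_sub_one_of_pos (div_pos hq hp)
    rw [Real.log_div hq.ne' hp.ne'] at h
    have h' := mul_le_mul_of_nonneg_left h hp.le
    have hpq : p * (q / p - 1) = q - p := by field_simp
    rw [hpq] at h'
    rw [Real.negMulLog]
    linarith

theorem neg_log_prod_inv_floor_le {d : ℕ} (x : Fin d → ℝ) :
    -Real.log (∏ j, ((1 + |(⌊x j⌋ : ℝ)|) ^ 2)⁻¹) ≤ d * (2 * Real.log (2 + ‖x‖)) := by
  rw [Real.log_prod fun j _ => by positivity, ← Finset.sum_neg_distrib]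
  refine (Finset.sum_le_card_nsmul _ _ (2 * Real.log (2 + ‖x‖)) fun j _ => ?_).trans
    (by simp)
  rw [Real.log_inv, neg_neg, Real.log_pow, Nat.cast_ofNat]
  have hx : |x j| ≤ ‖x‖ := norm_le_pi_norm x j
  have hfloor : |(⌊x j⌋ : ℝ)| ≤ |x j| + 1 := by
    have h1 := Int.floor_le (x j)
    have h2 := (Int.lt_floor_add_one (x j)).le
    rw [abs_le]
    constructor <;> linarith [neg_abs_le (x j), le_abs_self (x j)]
  exact mul_le_mul_of_nonneg_left (Real.log_le_log (by positivity) (by linarith)) two_pos.le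

theorem summable_negMulLog_preimage {Ω α : Type*} [MeasurableSpace Ω] [Countable α]
    [MeasurableSpace α] [MeasurableSingletonClass α] (μ : Measure Ω) [IsProbabilityMeasure μ]
    {F : Ω → α} (hF : Measurable F) {w : α → ℝ} (hw : ∀ k, 0 < w k) (hw1 : ∀ k, w k ≤ 1)
    (hwsum : Summable w) (hint : ∫⁻ x, ENNReal.ofReal (-Real.log (w (F x))) ∂μ ≠ ⊤) :
    Summable fun k => Real.negMulLog (μ (F ⁻¹' {k})).toReal := by
  rw [← lintegral_map (f := fun k => ENNReal.ofReal (-Real.log (w k)))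
    (measurable_of_countable _) hF, lintegral_countable'] at hint
  simp_rw [Measure.map_apply hF (measurableSet_singleton _)] at hint
  have hsum : Summable fun k => (μ (F ⁻¹' {k})).toReal * -Real.log (w k) := by
    refine (ENNReal.summable_toReal hint).congr fun k => ?_
    rw [ENNReal.toReal_mul, ENNReal.toReal_ofReal
      (neg_nonneg.2 (Real.log_nonpos (hw k).le (hw1 k))), mul_comm]
  exact (hsum.add hwsum).of_nonneg_of_le
    (fun k => Real.negMulLog_nonneg ENNReal.toReal_nonneg measureReal_le_one)
    fun k => negMulLog_le_mul_neg_log_add ENNReal.toReal_nonneg (hw k)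

theorem summable_negMulLog_floor {d : ℕ} {N : (Fin d → ℝ) → ℝ} (hN : IsNorm N)
    (μ : Measure (Fin d → ℝ)) [IsProbabilityMeasure μ]
    (hlog : ∫⁻ x, ENNReal.ofReal (Real.log (1 + N x)) ∂μ < ⊤) :
    Summable fun k : Fin d → ℤ =>
      Real.negMulLog (μ {x | ∀ j, ⌊x j⌋ = k j}).toReal := by
  obtain ⟨C, hC, hCN⟩ := hN.exists_norm_le_mul
  have hcell (k : Fin d → ℤ) : {x : Fin d → ℝ | ∀ j, ⌊x j⌋ = k j} =
      (fun x j => ⌊x j⌋) ⁻¹' {k} := by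
    ext x
    simp [funext_iff]
  have hpoint (x : Fin d → ℝ) : -Real.log (∏ j, ((1 + |(⌊x j⌋ : ℝ)|) ^ 2)⁻¹) ≤
      d * 2 * Real.log (2 + C) + d * 2 * Real.log (1 + N x) := by
    refine (neg_log_prod_inv_floor_le x).trans ?_
    have hNx := hN.nonneg x
    rw [← mul_add, ← Real.log_mul (by positivity) (by positivity), ← mul_assoc]
    refine mul_le_mul_of_nonneg_left (Real.log_le_log (by positivity) ?_) (by positivity)
    linarith [hCN x]
  have hF : Measurable fun (x : Fin d → ℝ) j => ⌊x j⌋ :=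
    measurable_pi_lambda _ fun j => Int.measurable_floor.comp (measurable_pi_apply j)
  have hint : ∫⁻ x, ENNReal.ofReal (-Real.log (∏ j, ((1 + |(⌊x j⌋ : ℝ)|) ^ 2)⁻¹)) ∂μ ≠ ⊤ := by
    refine ne_top_of_le_ne_top ?_ (lintegral_mono (g := fun x =>
      ENNReal.ofReal (d * 2 * Real.log (2 + C)) +
        ENNReal.ofReal (d * 2) * ENNReal.ofReal (Real.log (1 + N x))) fun x => ?_)
    · rw [lintegral_add_left measurable_const, lintegral_const_mul' _ _ ENNReal.ofReal_ne_top,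
        lintegral_const, measure_univ, mul_one]
      exact ENNReal.add_ne_top.2
        ⟨ENNReal.ofReal_ne_top, ENNReal.mul_ne_top ENNReal.ofReal_ne_top hlog.ne⟩
    · dsimp only
      rw [← ENNReal.ofReal_mul (by positivity)]
      exact (ENNReal.ofReal_le_ofReal (hpoint x)).trans ENNReal.ofReal_add_le
  have hw (k : Fin d → ℤ) : 0 < ∏ j, ((1 + |(k j : ℝ)|) ^ 2)⁻¹ :=
    Finset.prod_pos fun j _ => by positivity
  have hw1 (k : Fin d → ℤ) : ∏ j, ((1 + |(k j : ℝ)|) ^ 2)⁻¹ ≤ 1 :=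
    Finset.prod_le_one (fun j _ => by positivity) fun j _ =>
      inv_le_one_of_one_le₀ (one_le_pow₀ (by linarith [abs_nonneg (k j : ℝ)]))
  have hwsum : Summable fun k : Fin d → ℤ => ∏ j, ((1 + |(k j : ℝ)|) ^ 2)⁻¹ :=
    summable_prod_apply (f := fun n : ℤ => ((1 + |(n : ℝ)|) ^ 2)⁻¹) (fun n => by positivity)
      summable_int_inv_one_add_abs_sq
  simp_rw [hcell]
  exact summable_negMulLog_preimage μ hF hw hw1 hwsum hint

theorem log_one_add_le_log_two_add_rpow_div {t α : ℝ} (ht : 0 ≤ t) (hα : 0 < α) :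
    Real.log (1 + t) ≤ Real.log 2 + t ^ α / α := by
  rcases le_total t 1 with h | h
  · have h1 : Real.log (1 + t) ≤ Real.log 2 := Real.log_le_log (by linarith) (by linarith)
    have h2 : 0 ≤ t ^ α / α := by positivity
    linarith
  · calc Real.log (1 + t) ≤ Real.log (2 * t) := Real.log_le_log (by linarith) (by linarith)
      _ = Real.log 2 + Real.log t := Real.log_mul (by norm_num) (by linarith)
      _ ≤ _ := by gcongr; exact Real.log_le_rpow_div ht hα

/-- generalization of Wu-Verdú, Proposition 1: if
`E[log(1 + ‖X‖)] < ∞` then `H(⌊X⌋) < ∞`; in particular this holds whenever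
`E[‖X‖^α] < ∞` for some `α > 0`. -/
theorem floor_entropy_finite_of_log_moment {d : ℕ} (hd : 0 < d)
    {N : (Fin d → ℝ) → ℝ} (hN : IsNorm N)
    (μ : Measure (Fin d → ℝ)) [IsProbabilityMeasure μ] :
    ((∫⁻ x, ENNReal.ofReal (Real.log (1 + N x)) ∂μ < ⊤) →
      Summable fun k : Fin d → ℤ =>
        Real.negMulLog (μ {x | ∀ j, ⌊x j⌋ = k j}).toReal)
    ∧ ∀ α : ℝ, 0 < α → (∫⁻ x, ENNReal.ofReal (N x ^ α) ∂μ < ⊤) →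
        Summable fun k : Fin d → ℤ =>
          Real.negMulLog (μ {x | ∀ j, ⌊x j⌋ = k j}).toReal := by
  refine ⟨summable_negMulLog_floor hN μ, fun α hα h => summable_negMulLog_floor hN μ ?_⟩
  refine lt_of_le_of_lt (lintegral_mono (g := fun x =>
    ENNReal.ofReal (Real.log 2) + ENNReal.ofReal α⁻¹ * ENNReal.ofReal (N x ^ α)) fun x => ?_) ?_
  · dsimp only
    rw [← ENNReal.ofReal_mul (by positivity), mul_comm, ← div_eq_mul_inv]
    exact (ENNReal.ofReal_le_ofReal
      (log_one_add_le_log_two_add_rpow_div (hN.nonneg x) hα)).trans ENNReal.ofReal_add_le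
  · rw [lintegral_add_left measurable_const, lintegral_const_mul' _ _ ENNReal.ofReal_ne_top,
      lintegral_const, measure_univ, mul_one]
    exact ENNReal.add_lt_top.2
      ⟨ENNReal.ofReal_lt_top, ENNReal.mul_lt_top ENNReal.ofReal_lt_top h⟩

end
end
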